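/- arXiv:1210.3311 — 2 statements merged into one kernel-verified Lean document; each statement's English description precedes it below -/
import Mathlib

section
/- Let 0 < p ≤ q < ∞ and 0 < α < ∞ with pα > 1, let ω be a radial continuous weight on the unit disc that is either regular or rapidly increasing, and let μ be a positive Borel measure on 𝔻. Then there exists a constant C > 0 such that ∫_𝔻 (M_ω(|φ|^{1/α})(z))^{αq} dμ(z) ≤ C (∫_𝔻 |φ|^p ω dA)^{q/p} for all measurable φ on 𝔻 with ∫_𝔻 |φ|^p ω dA < ∞ if and only if K := sup_{I ⊂ 𝕋} μ(S(I)) / ω(S(I))^{q/p} < ∞; moreover, when this holds, the best constant C satisfies C ≍ K. -/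
open MeasureTheory Set Filter

noncomputable section

/-- `wInt ω r = ∫_r^1 ω(s) ds`. -/
def wInt (ω : ℝ → ℝ) (r : ℝ) : ℝ := ∫ s in r..1, ω s

/-- A radial weight on the unit disc, identified with a function on `[0,1)`:
positive and integrable. -/
def IsRadialWeight (ω : ℝ → ℝ) : Prop :=
  (∀ r ∈ Set.Ico (0:ℝ) 1, 0 < ω r) ∧ IntegrableOn ω (Set.Ico (0:ℝ) 1)

/-- A radial continuous weight. -/
def IsRadialContinuousWeight (ω : ℝ → ℝ) : Prop :=
  IsRadialWeight ω ∧ ContinuousOn ω (Set.Ico (0:ℝ) 1)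

/-- A regular weight: radial continuous with `ψ_ω(r) ≍ 1 - r`, i.e.
`(1-r)·ω(r) ≍ ∫_r^1 ω(s) ds` on `[0,1)`. -/
def IsRegularWeight (ω : ℝ → ℝ) : Prop :=
  IsRadialContinuousWeight ω ∧ ∃ c C : ℝ, 0 < c ∧ 0 < C ∧
    ∀ r ∈ Set.Ico (0:ℝ) 1,
      c * ((1 - r) * ω r) ≤ wInt ω r ∧ wInt ω r ≤ C * ((1 - r) * ω r)

/-- A rapidly increasing weight: radial continuous with
`ψ_ω(r)/(1-r) = (∫_r^1 ω)/(ω(r)(1-r)) → ∞` as `r → 1⁻`. -/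
def IsRapidlyIncreasing (ω : ℝ → ℝ) : Prop :=
  IsRadialContinuousWeight ω ∧
    Tendsto (fun r => wInt ω r / (ω r * (1 - r))) (nhdsWithin 1 (Set.Iio 1)) atTop

/-- The open unit disc in `ℂ`. -/
def unitDisc : Set ℂ := {z : ℂ | ‖z‖ < 1}

/-- The Carleson square `S(I)` associated with the arc `I ⊂ 𝕋` with midpoint `e^{iθ}` and
arc length `h`: `S(I) = {re^{it} ∈ 𝔻 : e^{it} ∈ I, 1 - h ≤ r < 1}`. -/
def CBox (θ h : ℝ) : Set ℂ :=
  {z : ℂ | 1 - h ≤ ‖z‖ ∧ ‖z‖ < 1 ∧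
    |Complex.arg (z * Complex.exp (-(θ : ℂ) * Complex.I))| ≤ h / 2}

/-- The weighted (Hörmander) maximal function
`M_ω(φ)(z) = sup_{I : z ∈ S(I)} (1/ω(S(I))) ∫_{S(I)} |φ| ω dA`, with values in `[0,∞]`. -/
def MaxFn (ω : ℝ → ℝ) (φ : ℂ → ℝ) (z : ℂ) : ENNReal :=
  ⨆ (θ : ℝ) (h : ℝ) (_ : 0 < h ∧ h ≤ 2 * Real.pi ∧ z ∈ CBox θ h),
    (∫⁻ ξ in CBox θ h, ENNReal.ofReal (|φ ξ| * ω ‖ξ‖)) /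
      (∫⁻ ξ in CBox θ h, ENNReal.ofReal (ω ‖ξ‖))

/-- Layer-cake formula for a single power, with values in `[0, ∞]`. -/
theorem setLIntegral_Ioi_indicator_rpow {p : ℝ} (hp : 0 < p) (a : ENNReal) :
    ∫⁻ x in Ioi (0 : ℝ), {x : ℝ | ENNReal.ofReal x < a}.indicator
      (fun x => ENNReal.ofReal (x ^ (p - 1))) x = a ^ p / ENNReal.ofReal p := by
  have key : ∀ b : ℝ, 0 ≤ b → ∫⁻ x in Ioi (0 : ℝ), {x : ℝ | x < b}.indicator
      (fun x => ENNReal.ofReal (x ^ (p - 1))) x = ENNReal.ofReal (b ^ p / p) := by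
    intro b hb
    rw [setLIntegral_indicator (s := {x : ℝ | x < b}) measurableSet_Iio]
    have hset : {x : ℝ | x < b} ∩ Ioi 0 = Ioo 0 b := by
      ext x; simp [and_comm]
    rw [hset, setLIntegral_congr Ioo_ae_eq_Ioc, ← ofReal_integral_eq_lintegral_ofReal]
    · rw [← intervalIntegral.integral_of_le hb, integral_rpow (Or.inl (by linarith))]
      simp [Real.zero_rpow hp.ne']
    · exact (intervalIntegrable_iff_integrableOn_Ioc_of_le hb).1
        (intervalIntegral.intervalIntegrable_rpow' (by linarith))
    · filter_upwards [ae_restrict_mem measurableSet_Ioc] with x hx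
      exact Real.rpow_nonneg hx.1.le _
  by_cases ha : a = ⊤
  · subst ha
    rw [ENNReal.top_rpow_of_pos hp, ENNReal.top_div_of_ne_top ENNReal.ofReal_ne_top, eq_top_iff]
    have hlim : Tendsto (fun n : ℕ => ENNReal.ofReal ((n : ℝ) ^ p / p)) atTop (nhds ⊤) :=
      ENNReal.tendsto_ofReal_atTop.comp
        (((tendsto_rpow_atTop hp).comp tendsto_natCast_atTop_atTop).atTop_div_const hp)
    refine le_of_tendsto' hlim fun n => ?_
    rw [← key n n.cast_nonneg]
    refine lintegral_mono fun x => indicator_le_indicator_of_subset ?_ (fun _ => zero_le) x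
    intro x _
    simp
  · lift a to NNReal using ha
    have h1 := key a (NNReal.coe_nonneg a)
    rw [ENNReal.ofReal_div_of_pos hp, ← ENNReal.ofReal_rpow_of_nonneg (NNReal.coe_nonneg a) hp.le,
      ENNReal.ofReal_coe_nnreal] at h1
    rw [← h1]
    refine setLIntegral_congr_fun measurableSet_Ioi fun x hx => ?_
    have : ({x : ℝ | ENNReal.ofReal x < (a : ENNReal)} : Set ℝ).indicator
        (fun x => ENNReal.ofReal (x ^ (p - 1))) x = ({x : ℝ | x < a} : Set ℝ).indicator
        (fun x => ENNReal.ofReal (x ^ (p - 1))) x := by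
      have : (ENNReal.ofReal x < (a : ENNReal)) ↔ x < a := by
        rw [← ENNReal.ofReal_coe_nnreal]
        exact ENNReal.ofReal_lt_ofReal_iff_of_nonneg (le_of_lt hx)
      simp only [indicator, mem_ofPred_eq, this]
    exact this

/-- A superadditivity inequality for powers with exponent at least one. -/
theorem ENNReal.tsum_rpow_le_rpow_tsum {ι : Type*} (a : ι → ENNReal) {t : ℝ} (ht : 1 ≤ t) :
    ∑' i, a i ^ t ≤ (∑' i, a i) ^ t := by
  have split : ∀ x : ENNReal, x ^ t = x * x ^ (t - 1) := fun x => by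
    conv_lhs => rw [show t = 1 + (t - 1) by ring]
    rw [ENNReal.rpow_add_of_nonneg _ _ zero_le_one (by linarith), ENNReal.rpow_one]
  calc ∑' i, a i ^ t = ∑' i, a i * a i ^ (t - 1) := by simp_rw [← split]
    _ ≤ ∑' i, a i * (∑' j, a j) ^ (t - 1) := by
        refine ENNReal.tsum_le_tsum fun i => ?_
        gcongr
        · exact ENNReal.le_tsum i
    _ = (∑' i, a i) ^ t := by rw [ENNReal.tsum_mul_right, ← split]

section AbstractMaximal

variable {X ι : Type*} [MeasurableSpace X] {ν μ : Measure X} {B B' : ι → Set X} {δ : ι → ℝ}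
  {R t : ℝ} {K : ENNReal}

/-- Weak-type estimate for the maximal function of a family of sets with the Vitali property. -/
theorem measure_maximal_gt_le [SFinite ν] (hδ : ∀ i, 0 ≤ δ i) (hR : ∀ i, δ i ≤ R)
    (hB : ∀ i, MeasurableSet (B i)) (hpos : ∀ i, ν (B i) ≠ 0)
    (hcov : ∀ i j, (B i ∩ B j).Nonempty → δ i ≤ 2 * δ j → B i ⊆ B' j) (ht : 1 ≤ t)
    (hK : ∀ i, μ (B' i) ≤ K * ν (B i) ^ t) (f : X → ENNReal)
    {l : ENNReal} (hl : l ≠ 0) (hl' : l ≠ ⊤) :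
    μ {x | ∃ i, x ∈ B i ∧ l * ν (B i) < ∫⁻ y in B i, f y ∂ν} ≤
      K * (l⁻¹ * ∫⁻ y, f y ∂ν) ^ t := by
  obtain ⟨u, hu, hdisj, hmax⟩ := Vitali.exists_disjoint_subfamily_covering_enlargement B
    {i | l * ν (B i) < ∫⁻ y in B i, f y ∂ν} δ 2 one_lt_two (fun i _ => hδ i) R (fun i _ => hR i)
    (fun i _ => nonempty_of_measure_ne_zero (hpos i))
  have hdisj' : Pairwise (Function.onFun Disjoint fun i : u => B i) := hdisj.subtype _ _
  have hcount : u.Countable := by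
    have h := Measure.countable_meas_pos_of_disjoint_iUnion (μ := ν) (As := fun i : u => B i)
      (fun i => hB i) hdisj'
    have huniv : {i : u | 0 < ν (B i)} = univ := by
      ext i; simpa [pos_iff_ne_zero] using hpos i
    rw [huniv, countable_univ_iff] at h
    exact h
  have : Countable u := hcount
  calc μ {x | ∃ i, x ∈ B i ∧ l * ν (B i) < ∫⁻ y in B i, f y ∂ν}
      ≤ μ (⋃ i : u, B' i) := by
        refine measure_mono ?_
        rintro x ⟨i, hxi, hi⟩
        obtain ⟨j, hj, hij, hδij⟩ := hmax i hi
        exact mem_iUnion.2 ⟨⟨j, hj⟩, hcov i j hij hδij hxi⟩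
    _ ≤ ∑' i : u, μ (B' i) := measure_iUnion_le _
    _ ≤ ∑' i : u, K * (l⁻¹ * ∫⁻ y in B i, f y ∂ν) ^ t := by
        refine ENNReal.tsum_le_tsum fun i => (hK i).trans ?_
        gcongr
        have h : l * ν (B i) < ∫⁻ y in B i, f y ∂ν := hu i.2
        calc ν (B i) = l⁻¹ * (l * ν (B i)) := by
              rw [← mul_assoc, ENNReal.inv_mul_cancel hl hl', one_mul]
          _ ≤ _ := by gcongr l⁻¹ * ?_
    _ = K * ∑' i : u, (l⁻¹ * ∫⁻ y in B i, f y ∂ν) ^ t := ENNReal.tsum_mul_left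
    _ ≤ K * (∑' i : u, l⁻¹ * ∫⁻ y in B i, f y ∂ν) ^ t := by
        gcongr
        exact ENNReal.tsum_rpow_le_rpow_tsum _ ht
    _ ≤ K * (l⁻¹ * ∫⁻ y, f y ∂ν) ^ t := by
        rw [ENNReal.tsum_mul_left, ← lintegral_iUnion (fun i : u => hB i) hdisj']
        gcongr K * (l⁻¹ * ?_) ^ t
        exact setLIntegral_le_lintegral _ _

/-- Weak-type estimate involving only the large values of the function. -/
theorem measure_maximal_gt_le_indicator [SFinite ν] (hδ : ∀ i, 0 ≤ δ i) (hR : ∀ i, δ i ≤ R)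
    (hB : ∀ i, MeasurableSet (B i)) (hpos : ∀ i, ν (B i) ≠ 0)
    (hcov : ∀ i j, (B i ∩ B j).Nonempty → δ i ≤ 2 * δ j → B i ⊆ B' j) (ht : 1 ≤ t)
    (hK : ∀ i, μ (B' i) ≤ K * ν (B i) ^ t) (f : X → ENNReal)
    {l : ENNReal} (hl : l ≠ 0) (hl' : l ≠ ⊤) :
    μ {x | ∃ i, x ∈ B i ∧ 2 * l * ν (B i) < ∫⁻ y in B i, f y ∂ν} ≤
      K * (l⁻¹ * ∫⁻ y, {y | l < f y}.indicator f y ∂ν) ^ t := by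
  refine le_trans (measure_mono ?_)
    (measure_maximal_gt_le hδ hR hB hpos hcov ht hK ({y | l < f y}.indicator f) hl hl')
  rintro x ⟨i, hx, hi⟩
  refine ⟨i, hx, ?_⟩
  have hle : ∫⁻ y in B i, f y ∂ν ≤
      ∫⁻ y in B i, {y | l < f y}.indicator f y ∂ν + l * ν (B i) := by
    rw [← setLIntegral_const, ← lintegral_add_right _ measurable_const]
    refine lintegral_mono fun y => ?_
    by_cases hy : l < f y
    · simp [indicator, hy]
    · simpa [indicator, hy] using not_lt.1 hy
  have h := hi.trans_le hle
  rw [two_mul, add_mul] at h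
  exact lt_of_add_lt_add_right h

/-- Strong-type estimate: a Carleson-type condition on `μ` yields boundedness of the maximal
operator from `L^s(ν)` to `L^{st}(μ)`. -/
theorem lintegral_maximal_rpow_le [SFinite ν] [SFinite μ] (hδ : ∀ i, 0 ≤ δ i)
    (hR : ∀ i, δ i ≤ R)
    (hB : ∀ i, MeasurableSet (B i)) (hpos : ∀ i, ν (B i) ≠ 0)
    (hcov : ∀ i j, (B i ∩ B j).Nonempty → δ i ≤ 2 * δ j → B i ⊆ B' j) (ht : 1 ≤ t)
    (hK : ∀ i, μ (B' i) ≤ K * ν (B i) ^ t) {f : X → ENNReal} (hf : Measurable f)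
    {s : ℝ} (hs : 1 < s) (M : X → ENNReal)
    (hM : ∀ x l, l < M x → ∃ i, x ∈ B i ∧ l * ν (B i) < ∫⁻ y in B i, f y ∂ν) :
    ∫⁻ x, M x ^ (s * t) ∂μ ≤
      ENNReal.ofReal (2 ^ (s * t) * (s * t / (s - 1))) * K * (∫⁻ y, f y ^ s ∂ν) ^ t := by
  have hst : 0 < s * t := by positivity
  have hs1 : 0 < s - 1 := by linarith
  set F := ∫⁻ y, f y ^ s ∂ν with hF
  obtain ⟨g, hgm, hgM, hg⟩ := exists_measurable_le_lintegral_eq μ (fun x => (2⁻¹ * M x) ^ (s * t))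
  have hlayer : ∫⁻ x, (2⁻¹ * M x) ^ (s * t) ∂μ = ENNReal.ofReal (s * t) *
      ∫⁻ l in Ioi (0 : ℝ), μ {x | ENNReal.ofReal l < g x ^ (s * t)⁻¹} *
        ENNReal.ofReal (l ^ (s * t - 1)) := by
    have hpt : ∀ x, g x = ENNReal.ofReal (s * t) * ∫⁻ l in Ioi (0 : ℝ),
        {l : ℝ | ENNReal.ofReal l < g x ^ (s * t)⁻¹}.indicator
          (fun l => ENNReal.ofReal (l ^ (s * t - 1))) l := by
      intro x
      rw [setLIntegral_Ioi_indicator_rpow hst, ENNReal.rpow_inv_rpow hst.ne',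
        ENNReal.mul_div_cancel (by simpa using hst) ENNReal.ofReal_ne_top]
    have hmeas : Measurable (Function.uncurry fun (x : X) (l : ℝ) =>
        {l : ℝ | ENNReal.ofReal l < g x ^ (s * t)⁻¹}.indicator
          (fun l => ENNReal.ofReal (l ^ (s * t - 1))) l) := by
      have : (Function.uncurry fun (x : X) (l : ℝ) =>
        {l : ℝ | ENNReal.ofReal l < g x ^ (s * t)⁻¹}.indicator
          (fun l => ENNReal.ofReal (l ^ (s * t - 1))) l) =
        {z : X × ℝ | ENNReal.ofReal z.2 < g z.1 ^ (s * t)⁻¹}.indicator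
          (fun z => ENNReal.ofReal (z.2 ^ (s * t - 1))) := by
        ext ⟨x, l⟩; simp [Function.uncurry, indicator]
      rw [this]
      exact (by fun_prop : Measurable fun z : X × ℝ => ENNReal.ofReal (z.2 ^ (s * t - 1))).indicator
        (measurableSet_lt (by fun_prop) (by fun_prop))
    rw [hg]
    conv_lhs => enter [2, x]; rw [hpt x]
    rw [lintegral_const_mul' _ _ ENNReal.ofReal_ne_top, lintegral_lintegral_swap hmeas.aemeasurable]
    congr 1
    refine lintegral_congr fun l => ?_
    have : ∀ x, {l : ℝ | ENNReal.ofReal l < g x ^ (s * t)⁻¹}.indicator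
          (fun l => ENNReal.ofReal (l ^ (s * t - 1))) l =
        {x | ENNReal.ofReal l < g x ^ (s * t)⁻¹}.indicator
          (fun _ => ENNReal.ofReal (l ^ (s * t - 1))) x := fun x => by simp [indicator]
    simp_rw [this]
    rw [lintegral_indicator_const (measurableSet_lt measurable_const (by fun_prop)), mul_comm]
  have hlevel : ∀ l ∈ Ioi (0 : ℝ), μ {x | ENNReal.ofReal l < g x ^ (s * t)⁻¹} *
      ENNReal.ofReal (l ^ (s * t - 1)) ≤ K * F ^ (t - 1) * (ENNReal.ofReal (l ^ (s - 1 - 1)) *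
        ∫⁻ y, {y | ENNReal.ofReal l < f y}.indicator f y ∂ν) := by
    intro l hl
    have hl : 0 < l := hl
    set L := ENNReal.ofReal l with hL
    have hL0 : L ≠ 0 := by simpa [hL] using hl
    have hLt : L ≠ ⊤ := ENNReal.ofReal_ne_top
    set J := ∫⁻ y, {y | L < f y}.indicator f y ∂ν with hJ
    have h1 : μ {x | L < g x ^ (s * t)⁻¹} ≤ K * (L⁻¹ * J) ^ t := by
      refine le_trans (measure_mono ?_)
        (measure_maximal_gt_le_indicator hδ hR hB hpos hcov ht hK f hL0 hLt)
      intro x hx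
      have hx : L < g x ^ (s * t)⁻¹ := hx
      refine hM x _ ?_
      have h2 : L < 2⁻¹ * M x := by
        refine hx.trans_le ?_
        rw [ENNReal.rpow_inv_le_iff hst]
        exact hgM x
      have h3 := ENNReal.mul_lt_mul_right two_ne_zero ENNReal.ofNat_ne_top h2
      rwa [← mul_assoc, ENNReal.mul_inv_cancel two_ne_zero ENNReal.ofNat_ne_top, one_mul] at h3
    have h2 : J ≤ L ^ (1 - s) * F := by
      rw [hF, ← lintegral_const_mul' _ _ (ENNReal.rpow_ne_top_of_ne_zero hL0 hLt)]
      refine lintegral_mono fun y => ?_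
      by_cases hy : L < f y
      · simp only [indicator, mem_ofPred_eq, hy, if_true]
        calc f y = L ^ (1 - s) * (L ^ (s - 1) * f y) := by
              rw [← mul_assoc, ← ENNReal.rpow_add _ _ hL0 hLt]; simp
          _ ≤ L ^ (1 - s) * (f y ^ (s - 1) * f y) := by gcongr
          _ = L ^ (1 - s) * f y ^ s := by
              conv_rhs => rw [show s = (s - 1) + 1 by ring]
              rw [ENNReal.rpow_add_of_nonneg _ _ hs1.le zero_le_one, ENNReal.rpow_one]
              simp
      · simp [indicator, hy]
    have h3 : (L⁻¹ * J) ^ t ≤ (L ^ (-t) * (L ^ (1 - s)) ^ (t - 1)) * F ^ (t - 1) * J := by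
      rw [ENNReal.mul_rpow_of_nonneg _ _ (by linarith), ENNReal.inv_rpow, ← ENNReal.rpow_neg]
      have : J ^ t = J ^ (t - 1) * J := by
        conv_lhs => rw [show t = (t - 1) + 1 by ring]
        rw [ENNReal.rpow_add_of_nonneg _ _ (by linarith) zero_le_one, ENNReal.rpow_one]
      rw [this]
      calc L ^ (-t) * (J ^ (t - 1) * J) ≤ L ^ (-t) * ((L ^ (1 - s) * F) ^ (t - 1) * J) := by
            gcongr
        _ = _ := by
            rw [ENNReal.mul_rpow_of_nonneg _ _ (by linarith)]; ring
    have hpow : ∀ r : ℝ, ENNReal.ofReal (l ^ r) = L ^ r := fun r =>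
      (ENNReal.ofReal_rpow_of_pos hl).symm
    have h4 : L ^ (-t) * (L ^ (1 - s)) ^ (t - 1) * L ^ (s * t - 1) = L ^ (s - 1 - 1) := by
      rw [← ENNReal.rpow_mul, ← ENNReal.rpow_add _ _ hL0 hLt, ← ENNReal.rpow_add _ _ hL0 hLt]
      congr 1; ring
    rw [hpow, hpow]
    calc _ ≤ K * ((L ^ (-t) * (L ^ (1 - s)) ^ (t - 1)) * F ^ (t - 1) * J) * L ^ (s * t - 1) := by
          gcongr
          exact h1.trans (by gcongr)
      _ = K * F ^ (t - 1) * ((L ^ (-t) * (L ^ (1 - s)) ^ (t - 1) * L ^ (s * t - 1)) * J) := by ring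
      _ = _ := by rw [h4]
  have hfub : ∫⁻ l in Ioi (0 : ℝ), ENNReal.ofReal (l ^ (s - 1 - 1)) *
        ∫⁻ y, {y | ENNReal.ofReal l < f y}.indicator f y ∂ν = F / ENNReal.ofReal (s - 1) := by
    have h1 : ∀ l : ℝ, ENNReal.ofReal (l ^ (s - 1 - 1)) *
        ∫⁻ y, {y | ENNReal.ofReal l < f y}.indicator f y ∂ν =
        ∫⁻ y, f y * {l : ℝ | ENNReal.ofReal l < f y}.indicator
          (fun l => ENNReal.ofReal (l ^ (s - 1 - 1))) l ∂ν := by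
      intro l
      rw [← lintegral_const_mul' _ _ ENNReal.ofReal_ne_top]
      refine lintegral_congr fun y => ?_
      by_cases hy : ENNReal.ofReal l < f y <;> simp [indicator, hy, mul_comm]
    simp_rw [h1]
    rw [lintegral_lintegral_swap]
    · have h2 : ∀ y, ∫⁻ l in Ioi (0 : ℝ), f y * {l : ℝ | ENNReal.ofReal l < f y}.indicator
          (fun l => ENNReal.ofReal (l ^ (s - 1 - 1))) l = f y ^ s * (ENNReal.ofReal (s - 1))⁻¹ := by
        intro y
        rw [lintegral_const_mul _ ((by fun_prop : Measurable fun l : ℝ =>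
          ENNReal.ofReal (l ^ (s - 1 - 1))).indicator (measurableSet_lt (by fun_prop) (by fun_prop))),
          setLIntegral_Ioi_indicator_rpow hs1, div_eq_mul_inv, ← mul_assoc]
        congr 1
        conv_rhs => rw [show s = 1 + (s - 1) by ring]
        rw [ENNReal.rpow_add_of_nonneg _ _ zero_le_one hs1.le, ENNReal.rpow_one]
      simp_rw [h2]
      rw [lintegral_mul_const' _ _ (by simpa using hs), div_eq_mul_inv]
    · have : (Function.uncurry fun (l : ℝ) (y : X) =>
        f y * {l : ℝ | ENNReal.ofReal l < f y}.indicator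
          (fun l => ENNReal.ofReal (l ^ (s - 1 - 1))) l) =
        fun z : ℝ × X => f z.2 * {z : ℝ × X | ENNReal.ofReal z.1 < f z.2}.indicator
          (fun z => ENNReal.ofReal (z.1 ^ (s - 1 - 1))) z := by
        ext ⟨l, x⟩; simp [Function.uncurry, indicator]
      rw [this]
      exact ((hf.comp measurable_snd).mul
        ((by fun_prop : Measurable fun z : ℝ × X => ENNReal.ofReal (z.1 ^ (s - 1 - 1))).indicator
        (measurableSet_lt (by fun_prop) (by fun_prop)))).aemeasurable
  have hgmeas : Measurable fun l : ℝ => ENNReal.ofReal (l ^ (s - 1 - 1)) *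
        ∫⁻ y, {y | ENNReal.ofReal l < f y}.indicator f y ∂ν := by
    refine Measurable.mul (by fun_prop) ?_
    refine Measurable.lintegral_prod_right' (f := fun z : ℝ × X =>
      {z : ℝ × X | ENNReal.ofReal z.1 < f z.2}.indicator (fun z => f z.2) z) ?_
    exact (hf.comp measurable_snd).indicator (measurableSet_lt (by fun_prop) (by fun_prop))
  have hscale : ∫⁻ x, M x ^ (s * t) ∂μ =
      ENNReal.ofReal (2 ^ (s * t)) * ∫⁻ x, (2⁻¹ * M x) ^ (s * t) ∂μ := by
    rw [← lintegral_const_mul' _ _ ENNReal.ofReal_ne_top]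
    refine lintegral_congr fun x => ?_
    rw [← ENNReal.ofReal_rpow_of_pos two_pos, ← ENNReal.mul_rpow_of_nonneg _ _ hst.le, ← mul_assoc]
    simp [ENNReal.mul_inv_cancel]
  have hFt : F ^ t = F ^ (t - 1) * F := by
    conv_lhs => rw [show t = (t - 1) + 1 by ring]
    rw [ENNReal.rpow_add_of_nonneg _ _ (by linarith) zero_le_one, ENNReal.rpow_one]
  rw [hscale, hlayer]
  calc _ ≤ ENNReal.ofReal (2 ^ (s * t)) * (ENNReal.ofReal (s * t) *
        ∫⁻ l in Ioi (0 : ℝ), K * F ^ (t - 1) * (ENNReal.ofReal (l ^ (s - 1 - 1)) *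
        ∫⁻ y, {y | ENNReal.ofReal l < f y}.indicator f y ∂ν)) := by
        gcongr _ * (_ * ?_)
        exact setLIntegral_mono' measurableSet_Ioi hlevel
    _ = _ := by
        rw [lintegral_const_mul _ hgmeas, hfub, ENNReal.ofReal_mul (p := 2 ^ (s * t)) (by positivity),
          ENNReal.ofReal_div_of_pos hs1, hFt, div_eq_mul_inv, div_eq_mul_inv]
        ring

end AbstractMaximal

/-- The measure `ω dA` on the unit disc (with unnormalized area measure). -/
def discMeasure (ω : ℝ → ℝ) : Measure ℂ :=
  volume.withDensity (unitDisc.indicator fun z => ENNReal.ofReal (ω ‖z‖))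

/-- The mass `∫_a^1 s ω(s) ds` of an annulus. -/
def annulusMass (ω : ℝ → ℝ) (a : ℝ) : ℝ := ∫ s in a..1, s * ω s

theorem measurableSet_unitDisc : MeasurableSet unitDisc :=
  measurableSet_lt measurable_norm measurable_const

theorem measurableSet_CBox (θ h : ℝ) : MeasurableSet (CBox θ h) := by
  have h1 : MeasurableSet {z : ℂ | 1 - h ≤ ‖z‖} := measurableSet_le measurable_const measurable_norm
  have h2 : MeasurableSet {z : ℂ | |Complex.arg (z * Complex.exp (-(θ : ℂ) * Complex.I))| ≤ h / 2} := by
    refine measurableSet_le ?_ measurable_const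
    exact (Complex.measurable_arg.comp (measurable_id.mul_const _)).norm
  exact h1.inter (measurableSet_unitDisc.inter h2)

theorem CBox_subset_unitDisc (θ h : ℝ) : CBox θ h ⊆ unitDisc := fun _ hz => hz.2.1

section Radial

variable {ω : ℝ → ℝ}

theorem IsRadialContinuousWeight.measurable_indicator (hω : IsRadialContinuousWeight ω) :
    Measurable (unitDisc.indicator fun z : ℂ => ENNReal.ofReal (ω ‖z‖)) := by
  have hc : ContinuousOn (fun z : ℂ => ENNReal.ofReal (ω ‖z‖)) unitDisc :=
    ENNReal.continuous_ofReal.comp_continuousOn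
      (hω.2.comp continuous_norm.continuousOn fun z hz => ⟨norm_nonneg z, hz⟩)
  classical
  rw [← piecewise_eq_indicator]
  exact hc.measurable_piecewise continuousOn_const measurableSet_unitDisc

theorem IsRadialContinuousWeight.intervalIntegrable (hω : IsRadialContinuousWeight ω) {a b : ℝ}
    (ha : 0 ≤ a) (hab : a ≤ b) (hb : b ≤ 1) : IntervalIntegrable ω volume a b := by
  rw [intervalIntegrable_iff_integrableOn_Ico_of_le hab]
  exact hω.1.2.mono_set (Ico_subset_Ico ha hb)

theorem IsRadialContinuousWeight.intervalIntegrable_mul (hω : IsRadialContinuousWeight ω)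
    {a b : ℝ} (ha : 0 ≤ a) (hab : a ≤ b) (hb : b ≤ 1) :
    IntervalIntegrable (fun s => s * ω s) volume a b :=
  (hω.intervalIntegrable ha hab hb).continuousOn_mul continuousOn_id

theorem IsRadialContinuousWeight.wInt_pos (hω : IsRadialContinuousWeight ω) {a : ℝ}
    (ha : 0 ≤ a) (ha1 : a < 1) : 0 < wInt ω a :=
  intervalIntegral.intervalIntegral_pos_of_pos_on (hω.intervalIntegrable ha ha1.le le_rfl)
    (fun s hs => hω.1.1 s ⟨ha.trans hs.1.le, hs.2⟩) ha1

theorem IsRadialContinuousWeight.annulusMass_pos (hω : IsRadialContinuousWeight ω) {a : ℝ}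
    (ha : 0 ≤ a) (ha1 : a < 1) : 0 < annulusMass ω a :=
  intervalIntegral.intervalIntegral_pos_of_pos_on (hω.intervalIntegrable_mul ha ha1.le le_rfl)
    (fun s hs => mul_pos (ha.trans_lt hs.1) (hω.1.1 s ⟨ha.trans hs.1.le, hs.2⟩)) ha1

theorem IsRadialContinuousWeight.wInt_antitone (hω : IsRadialContinuousWeight ω) {a b : ℝ}
    (ha : 0 ≤ a) (hab : a ≤ b) (hb : b ≤ 1) : wInt ω b ≤ wInt ω a := by
  have h := intervalIntegral.integral_add_adjacent_intervals (hω.intervalIntegrable ha hab hb)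
    (hω.intervalIntegrable (ha.trans hab) hb le_rfl)
  have h0 : 0 ≤ ∫ s in a..b, ω s := by
    have := intervalIntegral.integral_mono_on_of_le_Ioo hab
      (IntervalIntegrable.zero (μ := volume)) (hω.intervalIntegrable ha hab hb)
      (fun s hs => (hω.1.1 s ⟨ha.trans hs.1.le, hs.2.trans_le hb⟩).le)
    simpa using this
  unfold wInt
  linarith

theorem IsRadialContinuousWeight.mul_wInt_le_annulusMass (hω : IsRadialContinuousWeight ω)
    {a : ℝ} (ha : 0 ≤ a) (ha1 : a ≤ 1) : a * wInt ω a ≤ annulusMass ω a := by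
  unfold wInt annulusMass
  rw [← intervalIntegral.integral_const_mul]
  refine intervalIntegral.integral_mono_on_of_le_Ioo ha1
    ((hω.intervalIntegrable ha ha1 le_rfl).const_mul a)
    (hω.intervalIntegrable_mul ha ha1 le_rfl) fun s hs => ?_
  exact mul_le_mul_of_nonneg_right hs.1.le (hω.1.1 s ⟨ha.trans hs.1.le, hs.2⟩).le

/-- For regular and rapidly increasing weights the distortion function is bounded below by a
multiple of the distance to the boundary. -/
theorem exists_mul_le_wInt (hω : IsRegularWeight ω ∨ IsRapidlyIncreasing ω) :
    ∃ β : ℝ, 0 < β ∧ ∀ r ∈ Ico (0 : ℝ) 1, (1 - r) * ω r ≤ β * wInt ω r := by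
  rcases hω with ⟨hω, c, C, hc, -, h⟩ | ⟨hω, hlim⟩
  · refine ⟨c⁻¹, inv_pos.2 hc, fun r hr => ?_⟩
    rw [le_inv_mul_iff₀ hc]
    exact (h r hr).1
  · have hev := hlim.eventually_ge_atTop 1
    obtain ⟨l, hl, hl'⟩ := (mem_nhdsLT_iff_exists_Ioo_subset).1 hev
    set r₀ := max ((l + 1) / 2) 0 with hr₀
    have hl1 : l < 1 := hl
    have hr₀0 : 0 ≤ r₀ := le_max_right _ _
    have hr₀1 : r₀ < 1 := max_lt (by linarith) one_pos
    have hlr₀ : l < r₀ := lt_of_lt_of_le (by linarith) (le_max_left _ _)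
    have hcont : ContinuousOn (fun r => (1 - r) * ω r) (Icc 0 r₀) :=
      (continuous_const.sub continuous_id).continuousOn.mul
        (hω.2.mono (Icc_subset_Ico_right hr₀1))
    obtain ⟨M, hM⟩ := isCompact_Icc.bddAbove_image hcont
    have hw := hω.wInt_pos hr₀0 hr₀1
    refine ⟨max 1 (M / wInt ω r₀), lt_of_lt_of_le one_pos (le_max_left _ _), fun r hr => ?_⟩
    have hwr := hω.wInt_pos hr.1 hr.2
    rcases le_total r r₀ with h | h
    · have h1 : (1 - r) * ω r ≤ M := hM ⟨r, ⟨hr.1, h⟩, rfl⟩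
      have h2 : 0 ≤ (1 - r) * ω r := mul_nonneg (by linarith [hr.2]) (hω.1.1 r hr).le
      calc (1 - r) * ω r ≤ M := h1
        _ = M / wInt ω r₀ * wInt ω r₀ := by field_simp
        _ ≤ M / wInt ω r₀ * wInt ω r := by
            gcongr
            · exact div_nonneg (h2.trans h1) hw.le
            · exact hω.wInt_antitone hr.1 h hr₀1.le
        _ ≤ _ := by gcongr; exact le_max_right _ _
    · have h1 : 1 ≤ wInt ω r / (ω r * (1 - r)) := hl' ⟨hlr₀.trans_le h, hr.2⟩
      have h2 : 0 < ω r * (1 - r) := mul_pos (hω.1.1 r hr) (by linarith [hr.2])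
      rw [one_le_div h2] at h1
      calc (1 - r) * ω r = ω r * (1 - r) := mul_comm _ _
        _ ≤ 1 * wInt ω r := by rwa [one_mul]
        _ ≤ _ := by gcongr; exact le_max_left _ _

theorem IsRadialContinuousWeight.hasDerivAt_annulusMass (hω : IsRadialContinuousWeight ω)
    {s : ℝ} (hs : s ∈ Ioo (0 : ℝ) 1) : HasDerivAt (annulusMass ω) (-(s * ω s)) s := by
  have hnhds : Ico (0 : ℝ) 1 ∈ nhds s := Ico_mem_nhds hs.1 hs.2
  have hc : ContinuousOn (fun s => s * ω s) (Ico 0 1) := continuousOn_id.mul hω.2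
  refine intervalIntegral.integral_hasDerivAt_left
    (hω.intervalIntegrable_mul hs.1.le hs.2.le le_rfl) ?_ (hc.continuousAt hnhds)
  exact (hc.mono Ioo_subset_Ico_self).stronglyMeasurableAtFilter isOpen_Ioo s hs

theorem IsRadialContinuousWeight.continuousOn_annulusMass (hω : IsRadialContinuousWeight ω) :
    ContinuousOn (annulusMass ω) (Icc 0 1) := by
  have h := intervalIntegral.continuousOn_primitive_interval_left (μ := volume)
    (f := fun s => s * ω s) (a := 0) (b := 1) (by
      have := (hω.intervalIntegrable_mul le_rfl zero_le_one le_rfl)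
      rw [intervalIntegrable_iff_integrableOn_Icc_of_le zero_le_one] at this
      simpa using this)
  rwa [uIcc_of_le zero_le_one] at h

/-- Polynomial lower bound on the decay of the annulus mass. -/
theorem IsRadialContinuousWeight.annulusMass_le (hω : IsRadialContinuousWeight ω) {β : ℝ}
    (hβ : 0 < β) (h : ∀ r ∈ Ico (0 : ℝ) 1, (1 - r) * ω r ≤ β * wInt ω r) {a b : ℝ}
    (ha : 0 ≤ a) (hab : a ≤ b) (hb : b < 1) :
    annulusMass ω a ≤ ((1 - a) / (1 - b)) ^ β * annulusMass ω b := by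
  have hmono : MonotoneOn (fun s => annulusMass ω s * (1 - s) ^ (-β)) (Ico 0 1) := by
    have hd : ∀ s ∈ Ioo (0 : ℝ) 1, HasDerivAt (fun s => annulusMass ω s * (1 - s) ^ (-β))
        (-(s * ω s) * (1 - s) ^ (-β) + annulusMass ω s * (-1 * -β * (1 - s) ^ (-β - 1))) s := by
      intro s hs
      exact (hω.hasDerivAt_annulusMass hs).mul
        (((hasDerivAt_id s).const_sub 1).rpow_const (Or.inl (by simpa using (sub_pos.2 hs.2).ne')))
    refine monotoneOn_of_deriv_nonneg (convex_Ico 0 1) ?_ ?_ ?_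
    · refine (hω.continuousOn_annulusMass.mono Ico_subset_Icc_self).mul ?_
      exact (continuous_const.sub continuous_id).continuousOn.rpow_const
        fun s hs => Or.inl (sub_pos.2 hs.2).ne'
    · rw [interior_Ico]
      exact fun s hs => (hd s hs).differentiableAt.differentiableWithinAt
    · rw [interior_Ico]
      intro s hs
      rw [(hd s hs).deriv]
      have h1s : 0 < 1 - s := sub_pos.2 hs.2
      have hsplit : (1 - s) ^ (-β) = (1 - s) ^ (-β - 1) * (1 - s) := by
        rw [← Real.rpow_add_one h1s.ne']; simp
      rw [hsplit]
      have h1 := h s ⟨hs.1.le, hs.2⟩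
      have h2 := hω.mul_wInt_le_annulusMass hs.1.le hs.2.le
      have h3 : s * ω s * (1 - s) ≤ β * annulusMass ω s := by
        nlinarith [mul_le_mul_of_nonneg_left h1 hs.1.le, mul_le_mul_of_nonneg_left h2 hβ.le]
      have h4 : 0 < (1 - s) ^ (-β - 1) := Real.rpow_pos_of_pos h1s _
      nlinarith [mul_le_mul_of_nonneg_left h3 h4.le]
  have h1 := hmono ⟨ha, hab.trans_lt hb⟩ ⟨ha.trans hab, hb⟩ hab
  have hb' : 0 < 1 - b := sub_pos.2 hb
  have ha' : 0 < 1 - a := by linarith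
  simp only [Real.rpow_neg ha'.le, Real.rpow_neg hb'.le, ← div_eq_mul_inv] at h1
  rw [div_le_iff₀ (Real.rpow_pos_of_pos ha' _)] at h1
  rw [Real.div_rpow ha'.le hb'.le]
  calc _ ≤ _ := h1
    _ = _ := by ring

end Radial

section Geometry

theorem unitDisc_subset_CBox_two_pi (θ : ℝ) : unitDisc ⊆ CBox θ (2 * Real.pi) := fun z hz =>
  ⟨by linarith [norm_nonneg z, Real.pi_gt_three], hz, by
    simpa using Complex.abs_arg_le_pi _⟩

theorem abs_arg_mul_exp_neg {z : ℂ} (hz : z ≠ 0) (θ : ℝ) :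
    |Complex.arg (z * Complex.exp (-(θ : ℂ) * Complex.I))| =
      InnerProductGeometry.angle z (Complex.exp (θ * Complex.I)) := by
  rw [Complex.angle_eq_abs_arg hz (Complex.exp_ne_zero _), neg_mul, Complex.exp_neg,
    div_eq_mul_inv]

/-- The Vitali-type engulfing property of Carleson squares. -/
theorem CBox_subset_CBox {θ θ' h h' : ℝ}
    (hne : (CBox θ h ∩ CBox θ' h').Nonempty) (hh' : h ≤ 2 * h') :
    CBox θ h ⊆ CBox θ' (min (7 * h') (2 * Real.pi)) := by
  intro z hz
  rcases le_total (2 * Real.pi) (7 * h') with hbig | hsmall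
  · rw [min_eq_right hbig]
    exact unitDisc_subset_CBox_two_pi θ' hz.2.1
  · rw [min_eq_left hsmall]
    obtain ⟨w, hw, hw'⟩ := hne
    have h1 : h' < 1 := by linarith [Real.pi_lt_d2]
    have hw0 : w ≠ 0 := norm_pos_iff.1 (by linarith [hw'.1])
    have h0 : 0 ≤ h' := by linarith [(abs_nonneg _).trans hw'.2.2]
    refine ⟨by linarith [hz.1], hz.2.1, ?_⟩
    rcases eq_or_ne z 0 with rfl | hz0
    · simpa using div_nonneg (mul_nonneg (by norm_num) h0) zero_le_two
    · have hz3 := hz.2.2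
      have hw3 := hw.2.2
      have hw3' := hw'.2.2
      rw [abs_arg_mul_exp_neg hz0] at hz3 ⊢
      rw [abs_arg_mul_exp_neg hw0] at hw3 hw3'
      have t1 := InnerProductGeometry.angle_le_angle_add_angle z (Complex.exp (θ * Complex.I))
        (Complex.exp (θ' * Complex.I))
      have t2 := InnerProductGeometry.angle_le_angle_add_angle (Complex.exp (θ * Complex.I)) w
        (Complex.exp (θ' * Complex.I))
      rw [InnerProductGeometry.angle_comm _ w] at t2
      linarith

end Geometry

section DiscMeasure

variable {ω : ℝ → ℝ}

theorem IsRadialContinuousWeight.lintegral_discMeasure (hω : IsRadialContinuousWeight ω)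
    {g : ℂ → ℝ} (hg : Measurable g) (hg0 : ∀ z, 0 ≤ g z) {s : Set ℂ} (hs : MeasurableSet s)
    (hsub : s ⊆ unitDisc) :
    ∫⁻ z in s, ENNReal.ofReal (g z * ω ‖z‖) = ∫⁻ z in s, ENNReal.ofReal (g z) ∂discMeasure ω := by
  rw [discMeasure, setLIntegral_withDensity_eq_setLIntegral_mul _ hω.measurable_indicator
    hg.ennreal_ofReal hs]
  refine setLIntegral_congr_fun hs fun z hz => ?_
  simp only [Pi.mul_apply, indicator_of_mem (hsub hz)]
  rw [ENNReal.ofReal_mul (hg0 z), mul_comm]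

theorem discMeasure_compl_unitDisc : discMeasure ω unitDiscᶜ = 0 := by
  rw [discMeasure, withDensity_apply _ measurableSet_unitDisc.compl]
  rw [setLIntegral_congr_fun (g := fun _ => 0) measurableSet_unitDisc.compl
    fun z hz => indicator_of_notMem hz _]
  simp

theorem discMeasure_restrict_unitDisc : (discMeasure ω).restrict unitDisc = discMeasure ω :=
  Measure.restrict_eq_self_of_ae_mem (mem_ae_iff.2 discMeasure_compl_unitDisc)

theorem lintegral_CBox_eq_discMeasure (θ h : ℝ) :
    ∫⁻ z in CBox θ h, ENNReal.ofReal (ω ‖z‖) = discMeasure ω (CBox θ h) := by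
  rw [discMeasure, withDensity_apply _ (measurableSet_CBox θ h)]
  refine setLIntegral_congr_fun (measurableSet_CBox θ h) fun z hz => ?_
  simp only [indicator_of_mem (CBox_subset_unitDisc _ _ hz)]

theorem discMeasure_CBox_rotate (θ h : ℝ) :
    discMeasure ω (CBox θ h) = discMeasure ω (CBox 0 h) := by
  rw [← lintegral_CBox_eq_discMeasure, ← lintegral_CBox_eq_discMeasure]
  set e := rotation (Circle.exp (-θ)) with he
  have hpre : CBox θ h = e ⁻¹' CBox 0 h := by
    ext z
    have : e z = z * Complex.exp (-(θ : ℂ) * Complex.I) := by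
      rw [he, rotation_apply, Circle.coe_exp, Complex.ofReal_neg, mul_comm]
    have hn : ‖e z‖ = ‖z‖ := e.norm_map z
    simp only [CBox, mem_preimage, mem_ofPred_eq, hn]
    rw [this]
    simp
  rw [hpre, ← e.measurePreserving.setLIntegral_comp_preimage_emb
    e.toHomeomorph.measurableEmbedding _ (CBox 0 h)]
  simp

theorem IsRadialContinuousWeight.discMeasure_CBox (hω : IsRadialContinuousWeight ω) (θ : ℝ)
    {h : ℝ} (hh : 0 < h) (hh' : h ≤ 2 * Real.pi) :
    discMeasure ω (CBox θ h) = ENNReal.ofReal h * ENNReal.ofReal (annulusMass ω (max (1 - h) 0)) := by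
  set a := max (1 - h) 0 with ha
  have ha0 : 0 ≤ a := le_max_right _ _
  have ha1 : a < 1 := max_lt (by linarith) one_pos
  rw [discMeasure_CBox_rotate, ← lintegral_CBox_eq_discMeasure,
    ← lintegral_indicator (measurableSet_CBox 0 h), ← Complex.lintegral_comp_polarCoord_symm]
  have hpt : ∀ p ∈ polarCoord.target, ENNReal.ofReal p.1 •
      (CBox 0 h).indicator (fun z => ENNReal.ofReal (ω ‖z‖)) (Complex.polarCoord.symm p) =
      (Ico a 1).indicator (fun r => ENNReal.ofReal (r * ω r)) p.1 *
        (Icc (-(h / 2)) (h / 2)).indicator 1 p.2 := by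
    rintro ⟨r, t⟩ ⟨hr, ht⟩
    have hr : 0 < r := hr
    have ht : t ∈ Ioo (-Real.pi) Real.pi := ht
    have hnorm : ‖Complex.polarCoord.symm (r, t)‖ = r := by
      rw [Complex.norm_polarCoord_symm, abs_of_pos hr]
    have harg : Complex.arg (Complex.polarCoord.symm (r, t)) = t := by
      rw [Complex.polarCoord_symm_apply]
      simpa using Complex.arg_mul_cos_add_sin_mul_I hr (Ioo_subset_Ioc_self ht)
    have hmem : Complex.polarCoord.symm (r, t) ∈ CBox 0 h ↔
        r ∈ Ico a 1 ∧ t ∈ Icc (-(h / 2)) (h / 2) := by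
      simp only [CBox, mem_ofPred_eq, hnorm, Complex.ofReal_zero, neg_zero, zero_mul,
        Complex.exp_zero, mul_one, harg, abs_le, mem_Ico, mem_Icc, ha, sup_le_iff, hr.le, and_true,
        and_assoc]
    by_cases h1 : r ∈ Ico a 1 <;> by_cases h2 : t ∈ Icc (-(h / 2)) (h / 2)
    · rw [indicator_of_mem (hmem.2 ⟨h1, h2⟩), indicator_of_mem h1, indicator_of_mem h2, hnorm,
        smul_eq_mul, ENNReal.ofReal_mul hr.le]
      simp
    all_goals
      rw [indicator_of_notMem (fun hm => by have := hmem.1 hm; tauto)]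
      simp [h1, h2]
  have htm : MeasurableSet polarCoord.target := polarCoord.open_target.measurableSet
  rw [setLIntegral_congr_fun htm hpt]
  have hωm : AEMeasurable ((Ico a 1).indicator fun r => ENNReal.ofReal (r * ω r))
      (volume.restrict (Ioi (0 : ℝ))) := by
    refine AEMeasurable.restrict ((aemeasurable_indicator_iff measurableSet_Ico).2 ?_)
    exact ((intervalIntegrable_iff_integrableOn_Ico_of_le ha1.le).1
      (hω.intervalIntegrable_mul ha0 ha1.le le_rfl)).aemeasurable.ennreal_ofReal
  have hprod : (volume : Measure (ℝ × ℝ)).restrict polarCoord.target =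
      (volume.restrict (Ioi (0 : ℝ))).prod (volume.restrict (Ioo (-Real.pi) Real.pi)) := by
    rw [Measure.prod_restrict]; rfl
  rw [hprod, lintegral_prod_mul hωm (by
    exact (measurable_one.indicator measurableSet_Icc).aemeasurable)]
  have hang : ∫⁻ t in Ioo (-Real.pi) Real.pi, (Icc (-(h / 2)) (h / 2)).indicator (1 : ℝ → ENNReal) t =
      ENNReal.ofReal h := by
    rw [setLIntegral_congr Ioo_ae_eq_Icc, lintegral_indicator_one measurableSet_Icc,
      Measure.restrict_apply measurableSet_Icc, inter_eq_left.2 (Icc_subset_Icc (by linarith)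
      (by linarith)), Real.volume_Icc]
    congr 1; ring
  have hrad : ∫⁻ r in Ioi (0 : ℝ), (Ico a 1).indicator (fun r => ENNReal.ofReal (r * ω r)) r =
      ENNReal.ofReal (annulusMass ω a) := by
    rw [setLIntegral_congr Ioi_ae_eq_Ici, setLIntegral_indicator measurableSet_Ico,
      inter_eq_left.2 (show Ico a 1 ⊆ Ici 0 from fun r hr => ha0.trans hr.1), annulusMass,
      intervalIntegral.integral_of_le ha1.le, integral_Ioc_eq_integral_Ioo,
      ← integral_Ico_eq_integral_Ioo, ofReal_integral_eq_lintegral_ofReal]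
    · exact (intervalIntegrable_iff_integrableOn_Ico_of_le ha1.le).1
        (hω.intervalIntegrable_mul ha0 ha1.le le_rfl)
    · filter_upwards [ae_restrict_mem measurableSet_Ico] with r hr
      exact mul_nonneg (ha0.trans hr.1) (hω.1.1 r ⟨ha0.trans hr.1, hr.2⟩).le
  rw [hang, hrad, mul_comm]

theorem IsRadialContinuousWeight.discMeasure_CBox_ne_zero (hω : IsRadialContinuousWeight ω)
    (θ : ℝ) {h : ℝ} (hh : 0 < h) (hh' : h ≤ 2 * Real.pi) : discMeasure ω (CBox θ h) ≠ 0 := by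
  rw [hω.discMeasure_CBox θ hh hh']
  have := hω.annulusMass_pos (le_max_right (1 - h) 0) (max_lt (by linarith) one_pos)
  simp [hh, this]

theorem IsRadialContinuousWeight.discMeasure_CBox_ne_top (hω : IsRadialContinuousWeight ω)
    (θ : ℝ) {h : ℝ} (hh : 0 < h) (hh' : h ≤ 2 * Real.pi) : discMeasure ω (CBox θ h) ≠ ⊤ := by
  rw [hω.discMeasure_CBox θ hh hh']
  exact ENNReal.mul_ne_top ENNReal.ofReal_ne_top ENNReal.ofReal_ne_top

/-- Doubling property of regular and rapidly increasing weights on Carleson squares. -/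
theorem exists_discMeasure_CBox_le (hω : IsRegularWeight ω ∨ IsRapidlyIncreasing ω) :
    ∃ D : ℝ, 0 < D ∧ ∀ θ h : ℝ, 0 < h → h ≤ 2 * Real.pi →
      discMeasure ω (CBox θ (min (7 * h) (2 * Real.pi))) ≤
        ENNReal.ofReal D * discMeasure ω (CBox θ h) := by
  obtain ⟨β, hβ, hβ'⟩ := exists_mul_le_wInt hω
  have hω : IsRadialContinuousWeight ω := hω.elim And.left And.left
  refine ⟨7 * 7 ^ β, by positivity, fun θ h hh hh' => ?_⟩
  set H := min (7 * h) (2 * Real.pi) with hH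
  have hHh : h ≤ H := le_min (by linarith) hh'
  have hH7 : H ≤ 7 * h := min_le_left _ _
  have hH0 : 0 < H := hh.trans_le hHh
  rw [hω.discMeasure_CBox θ hH0 (min_le_right _ _), hω.discMeasure_CBox θ hh hh']
  have hb1 : max (1 - h) 0 < 1 := max_lt (by linarith) one_pos
  have hmass := hω.annulusMass_pos (le_max_right (1 - h) 0) hb1
  have key := hω.annulusMass_le hβ hβ' (le_max_right (1 - H) 0)
    (max_le_max_right 0 (by linarith : 1 - H ≤ 1 - h)) hb1
  have hratio : (1 - max (1 - H) 0) / (1 - max (1 - h) 0) ≤ 7 := by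
    rw [div_le_iff₀ (by linarith)]
    rcases le_total (1 - h) 0 with h0 | h0
    · rw [max_eq_right h0]
      linarith [le_max_right (1 - H) 0]
    · rw [max_eq_left h0]
      linarith [le_max_left (1 - H) 0]
  have hratio0 : 0 ≤ (1 - max (1 - H) 0) / (1 - max (1 - h) 0) :=
    div_nonneg (sub_nonneg.2 (max_le (by linarith) zero_le_one)) (by linarith)
  have key' : annulusMass ω (max (1 - H) 0) ≤ 7 ^ β * annulusMass ω (max (1 - h) 0) :=
    key.trans (by gcongr)
  rw [← ENNReal.ofReal_mul hH0.le, ← ENNReal.ofReal_mul hh.le,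
    ← ENNReal.ofReal_mul (by positivity)]
  refine ENNReal.ofReal_le_ofReal ?_
  calc H * annulusMass ω (max (1 - H) 0)
      ≤ 7 * h * (7 ^ β * annulusMass ω (max (1 - h) 0)) :=
        mul_le_mul hH7 key'
          (hω.annulusMass_pos (le_max_right _ _) (max_lt (by linarith) one_pos)).le (by positivity)
    _ = _ := by ring

end DiscMeasure

section Main

variable {ω : ℝ → ℝ} {p q α : ℝ}

theorem IsRadialContinuousWeight.maxFn_eq (hω : IsRadialContinuousWeight ω) {f : ℂ → ℝ}
    (hf : Measurable f) (z : ℂ) :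
    MaxFn ω f z = ⨆ (θ : ℝ) (h : ℝ) (_ : 0 < h ∧ h ≤ 2 * Real.pi ∧ z ∈ CBox θ h),
      (∫⁻ ξ in CBox θ h, ENNReal.ofReal |f ξ| ∂discMeasure ω) / discMeasure ω (CBox θ h) := by
  unfold MaxFn
  simp_rw [lintegral_CBox_eq_discMeasure]
  have h1 : ∀ θ h : ℝ, ∫⁻ ξ in CBox θ h, ENNReal.ofReal (|f ξ| * ω ‖ξ‖) =
      ∫⁻ ξ in CBox θ h, ENNReal.ofReal |f ξ| ∂discMeasure ω := fun θ h =>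
    hω.lintegral_discMeasure hf.abs (fun _ => abs_nonneg _) (measurableSet_CBox θ h)
      (CBox_subset_unitDisc θ h)
  simp_rw [h1]

theorem IsRadialContinuousWeight.lintegral_rpow_discMeasure (hω : IsRadialContinuousWeight ω)
    {φ : ℂ → ℝ} (hφ : Measurable φ) (p : ℝ) :
    ∫⁻ z in unitDisc, ENNReal.ofReal (|φ z| ^ p * ω ‖z‖) =
      ∫⁻ z, ENNReal.ofReal (|φ z| ^ p) ∂discMeasure ω := by
  rw [hω.lintegral_discMeasure (hφ.abs.pow_const p) (fun _ => by positivity)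
    measurableSet_unitDisc subset_rfl, discMeasure_restrict_unitDisc]

/-- A Carleson-type condition on `μ` implies boundedness of the maximal operator. -/
theorem exists_lintegral_maxFn_le (hp : 0 < p) (hpq : p ≤ q) (hα : 0 < α) (hpα : 1 < p * α)
    (hω : IsRegularWeight ω ∨ IsRapidlyIncreasing ω) :
    ∃ c : ℝ, 0 < c ∧ ∀ μ : Measure ℂ, μ {z : ℂ | ¬ ‖z‖ < 1} = 0 → ∀ K : ℝ, 0 ≤ K →
      (∀ θ h : ℝ, 0 < h → h ≤ 2 * Real.pi →
        μ (CBox θ h) ≤ ENNReal.ofReal K *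
          (∫⁻ ξ in CBox θ h, ENNReal.ofReal (ω ‖ξ‖)) ^ (q / p)) →
      ∀ φ : ℂ → ℝ, Measurable φ →
        (∫⁻ z, ((MaxFn ω (fun ξ => |φ ξ| ^ (1 / α)) z) ^ α) ^ q ∂μ) ≤
          ENNReal.ofReal (c * K) *
            (∫⁻ z in unitDisc, ENNReal.ofReal (|φ z| ^ p * ω ‖z‖)) ^ (q / p) := by
  obtain ⟨D, hD, hdoub⟩ := exists_discMeasure_CBox_le hω
  have hω : IsRadialContinuousWeight ω := hω.elim And.left And.left
  have ht : 1 ≤ q / p := (one_le_div hp).2 hpq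
  have hs1 : 0 < p * α - 1 := by linarith
  refine ⟨2 ^ (p * α * (q / p)) * (p * α * (q / p) / (p * α - 1)) * D ^ (q / p), by positivity,
    fun μ hμ K hK hcarl φ hφ => ?_⟩
  simp_rw [lintegral_CBox_eq_discMeasure] at hcarl
  have hπ := Real.pi_pos
  have hfin : IsFiniteMeasure μ := by
    refine ⟨?_⟩
    have hcompl : μ unitDiscᶜ = 0 := hμ
    calc μ univ ≤ μ unitDisc + μ unitDiscᶜ := by
          rw [← union_compl_self unitDisc]; exact measure_union_le _ _
      _ ≤ μ (CBox 0 (2 * Real.pi)) := by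
          rw [hcompl, add_zero]; exact measure_mono (unitDisc_subset_CBox_two_pi 0)
      _ ≤ _ := hcarl 0 (2 * Real.pi) (by positivity) le_rfl
      _ < ⊤ := ENNReal.mul_lt_top ENNReal.ofReal_lt_top (ENNReal.rpow_lt_top_of_nonneg
          (by linarith) (hω.discMeasure_CBox_ne_top _ (by positivity) le_rfl))
  have hsfin : SFinite (discMeasure ω) := by unfold discMeasure; infer_instance
  have hfm : Measurable fun ξ => |φ ξ| ^ (1 / α) := hφ.abs.pow_const _
  have main := lintegral_maximal_rpow_le (ν := discMeasure ω) (μ := μ)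
    (ι := {i : ℝ × ℝ // 0 < i.2 ∧ i.2 ≤ 2 * Real.pi})
    (B := fun i => CBox i.1.1 i.1.2) (B' := fun i => CBox i.1.1 (min (7 * i.1.2) (2 * Real.pi)))
    (δ := fun i => i.1.2) (R := 2 * Real.pi) (t := q / p)
    (K := ENNReal.ofReal K * ENNReal.ofReal (D ^ (q / p)))
    (fun i => i.2.1.le) (fun i => i.2.2) (fun i => measurableSet_CBox _ _)
    (fun i => hω.discMeasure_CBox_ne_zero _ i.2.1 i.2.2)
    (fun i j hne hij => CBox_subset_CBox hne hij) ht
    (fun i => by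
      refine (hcarl _ _ (lt_min (by linarith [i.2.1]) (by positivity)) (min_le_right _ _)).trans ?_
      rw [mul_assoc, ← ENNReal.ofReal_rpow_of_pos hD, ← ENNReal.mul_rpow_of_nonneg _ _
        (by linarith)]
      gcongr
      exact hdoub _ _ i.2.1 i.2.2)
    (f := fun ξ => ENNReal.ofReal |(|φ ξ| ^ (1 / α))|) hfm.abs.ennreal_ofReal hpα
    (MaxFn ω fun ξ => |φ ξ| ^ (1 / α))
    (fun z l hl => by
      rw [hω.maxFn_eq hfm] at hl
      simp only [lt_iSup_iff] at hl
      obtain ⟨θ, h, ⟨h0, h1, hz⟩, hl⟩ := hl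
      refine ⟨⟨(θ, h), h0, h1⟩, hz, ?_⟩
      exact (ENNReal.lt_div_iff_mul_lt (Or.inl (hω.discMeasure_CBox_ne_zero θ h0 h1))
        (Or.inl (hω.discMeasure_CBox_ne_top θ h0 h1))).1 hl)
  have hpow : ∀ ξ, ENNReal.ofReal |(|φ ξ| ^ (1 / α))| ^ (p * α) = ENNReal.ofReal (|φ ξ| ^ p) := by
    intro ξ
    rw [abs_of_nonneg (by positivity), ENNReal.ofReal_rpow_of_nonneg (by positivity)
      (by positivity), ← Real.rpow_mul (abs_nonneg _)]
    congr 2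
    field_simp
  simp_rw [hpow, ← hω.lintegral_rpow_discMeasure hφ] at main
  have hexp : p * α * (q / p) = α * q := by field_simp
  simp_rw [← ENNReal.rpow_mul]
  rw [hexp] at main ⊢
  refine main.trans (le_of_eq ?_)
  congr 1
  rw [← ENNReal.ofReal_mul hK, ← ENNReal.ofReal_mul (by
    have : 0 < q := hp.trans_le hpq
    positivity)]
  congr 1
  ring

/-- Boundedness of the maximal operator implies the Carleson-type condition. -/
theorem measure_CBox_le_of_lintegral_maxFn_le (hp : 0 < p) (hpq : p ≤ q) (hα : 0 < α)
    (hω : IsRadialContinuousWeight ω) {μ : Measure ℂ} {C : ℝ}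
    (hC : ∀ φ : ℂ → ℝ, Measurable φ →
      (∫⁻ z in unitDisc, ENNReal.ofReal (|φ z| ^ p * ω ‖z‖)) < ⊤ →
      (∫⁻ z, ((MaxFn ω (fun ξ => |φ ξ| ^ (1 / α)) z) ^ α) ^ q ∂μ) ≤
        ENNReal.ofReal C *
          (∫⁻ z in unitDisc, ENNReal.ofReal (|φ z| ^ p * ω ‖z‖)) ^ (q / p))
    {θ h : ℝ} (hh : 0 < h) (hh' : h ≤ 2 * Real.pi) :
    μ (CBox θ h) ≤ ENNReal.ofReal C *
      (∫⁻ ξ in CBox θ h, ENNReal.ofReal (ω ‖ξ‖)) ^ (q / p) := by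
  have hm := measurableSet_CBox θ h
  set φ : ℂ → ℝ := (CBox θ h).indicator 1 with hφ
  have hφm : Measurable φ := measurable_one.indicator hm
  have hpow : ∀ r : ℝ, 0 < r → ∀ z, ENNReal.ofReal (|φ z| ^ r) = (CBox θ h).indicator 1 z := by
    intro r hr z
    by_cases hz : z ∈ CBox θ h <;> simp [hφ, hz, Real.zero_rpow hr.ne']
  have hnorm : ∫⁻ z in unitDisc, ENNReal.ofReal (|φ z| ^ p * ω ‖z‖) =
      discMeasure ω (CBox θ h) := by
    rw [hω.lintegral_rpow_discMeasure hφm]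
    simp_rw [hpow p hp]
    exact lintegral_indicator_one hm
  have h0 := hω.discMeasure_CBox_ne_zero θ hh hh'
  have htop := hω.discMeasure_CBox_ne_top θ hh hh'
  have key := hC φ hφm (by rw [hnorm]; exact htop.lt_top)
  rw [hnorm] at key
  rw [lintegral_CBox_eq_discMeasure]
  refine le_trans ?_ key
  have hM : ∀ z ∈ CBox θ h, 1 ≤ MaxFn ω (fun ξ => |φ ξ| ^ (1 / α)) z := by
    intro z hz
    rw [hω.maxFn_eq (hφm.abs.pow_const _)]
    refine le_trans ?_ (le_iSup_of_le θ (le_iSup_of_le h (le_iSup_of_le ⟨hh, hh', hz⟩ le_rfl)))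
    have habs : ∀ ξ, |(|φ ξ| ^ (1 / α))| = |φ ξ| ^ (1 / α) := fun ξ => abs_of_nonneg (by positivity)
    simp_rw [habs, hpow (1 / α) (by positivity)]
    rw [lintegral_indicator_one hm, Measure.restrict_apply_self, ENNReal.div_self h0 htop]
  rw [← lintegral_indicator_one hm]
  refine lintegral_mono fun z => ?_
  by_cases hz : z ∈ CBox θ h
  · rw [indicator_of_mem hz, Pi.one_apply]
    exact ENNReal.one_le_rpow (ENNReal.one_le_rpow (hM z hz) hα) (hp.trans_le hpq)
  · rw [indicator_of_notMem hz]
    exact zero_le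

end Main

theorem stmt9 (p q α : ℝ) (hp : 0 < p) (hpq : p ≤ q) (hα : 0 < α) (hpα : 1 < p * α)
    (ω : ℝ → ℝ) (hω : IsRegularWeight ω ∨ IsRapidlyIncreasing ω) :
    ∃ c₁ c₂ : ℝ, 0 < c₁ ∧ 0 < c₂ ∧
      ∀ μ : Measure ℂ, μ {z : ℂ | ¬ ‖z‖ < 1} = 0 →
        -- the qualitative characterization:
        (((∃ C : ℝ, 0 < C ∧ ∀ φ : ℂ → ℝ, Measurable φ →
            (∫⁻ z in unitDisc, ENNReal.ofReal (|φ z| ^ p * ω ‖z‖)) < ⊤ →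
            (∫⁻ z, ((MaxFn ω (fun ξ => |φ ξ| ^ (1 / α)) z) ^ α) ^ q ∂μ) ≤
              ENNReal.ofReal C *
                (∫⁻ z in unitDisc, ENNReal.ofReal (|φ z| ^ p * ω ‖z‖)) ^ (q / p)) ↔
          (∃ K : ℝ, 0 ≤ K ∧ ∀ θ h : ℝ, 0 < h → h ≤ 2 * Real.pi →
            μ (CBox θ h) ≤ ENNReal.ofReal K *
              (∫⁻ ξ in CBox θ h, ENNReal.ofReal (ω ‖ξ‖)) ^ (q / p))) ∧
        -- one half of `‖[M_ω((·)^{1/α})]^α‖^q ≍ sup_I μ(S(I))/ω(S(I))^{q/p}`: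
        (∀ K : ℝ, 0 ≤ K →
          (∀ θ h : ℝ, 0 < h → h ≤ 2 * Real.pi →
            μ (CBox θ h) ≤ ENNReal.ofReal K *
              (∫⁻ ξ in CBox θ h, ENNReal.ofReal (ω ‖ξ‖)) ^ (q / p)) →
          ∀ φ : ℂ → ℝ, Measurable φ →
            (∫⁻ z in unitDisc, ENNReal.ofReal (|φ z| ^ p * ω ‖z‖)) < ⊤ →
            (∫⁻ z, ((MaxFn ω (fun ξ => |φ ξ| ^ (1 / α)) z) ^ α) ^ q ∂μ) ≤
              ENNReal.ofReal (c₂ * K) *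
                (∫⁻ z in unitDisc, ENNReal.ofReal (|φ z| ^ p * ω ‖z‖)) ^ (q / p)) ∧
        -- and the other half:
        (∀ C : ℝ, 0 ≤ C →
          (∀ φ : ℂ → ℝ, Measurable φ →
            (∫⁻ z in unitDisc, ENNReal.ofReal (|φ z| ^ p * ω ‖z‖)) < ⊤ →
            (∫⁻ z, ((MaxFn ω (fun ξ => |φ ξ| ^ (1 / α)) z) ^ α) ^ q ∂μ) ≤
              ENNReal.ofReal C *
                (∫⁻ z in unitDisc, ENNReal.ofReal (|φ z| ^ p * ω ‖z‖)) ^ (q / p)) →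
          ∀ θ h : ℝ, 0 < h → h ≤ 2 * Real.pi →
            μ (CBox θ h) ≤ ENNReal.ofReal (c₁ * C) *
              (∫⁻ ξ in CBox θ h, ENNReal.ofReal (ω ‖ξ‖)) ^ (q / p))) := by
  have hc : IsRadialContinuousWeight ω := hω.elim And.left And.left
  obtain ⟨c, hc0, hcar⟩ := exists_lintegral_maxFn_le hp hpq hα hpα hω
  refine ⟨1, c, one_pos, hc0, fun μ hμ => ⟨⟨?_, ?_⟩, ?_, ?_⟩⟩
  · rintro ⟨C, hC0, hC⟩
    exact ⟨C, hC0.le, fun θ h hh hh' =>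
      measure_CBox_le_of_lintegral_maxFn_le hp hpq hα hc hC hh hh'⟩
  · rintro ⟨K, hK0, hK⟩
    refine ⟨c * K + 1, by positivity, fun φ hφ _ => (hcar μ hμ K hK0 hK φ hφ).trans ?_⟩
    gcongr
    linarith
  · exact fun K hK0 hK φ hφ _ => hcar μ hμ K hK0 hK φ hφ
  · intro C _ hC θ h hh hh'
    rw [one_mul]
    exact measure_CBox_le_of_lintegral_maxFn_le hp hpq hα hc hC hh hh'
end
end

section
/- Let 0 < p < ∞, let ω be a radial weight on the unit disc, and let f be analytic on 𝔻. Then ∫_𝔻 |f(z)|^p ω(z) dA(z) = p² ∫_𝔻 |f(z)|^{p−2} |f'(z)|² ω*(z) dA(z) + ω(𝔻) |f(0)|^p. In particular, for p = 2, ‖f‖²_{A²_ω} = 4 ∫_𝔻 |f'(z)|² ω*(z) dA(z) + ω(𝔻)|f(0)|². -/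
open MeasureTheory Set Filter

noncomputable section

/-- The associated weight `ω*(z) = ∫_{|z|}^1 ω(s) log (s/|z|) s ds`. -/
def wStar (ω : ℝ → ℝ) (z : ℂ) : ℝ := ∫ s in ‖z‖..1, ω s * Real.log (s / ‖z‖) * s

/-- The point of `ℂ` with polar coordinates `(t, θ)`. -/
def polarPt (t θ : ℝ) : ℂ := t * Complex.exp (θ * Complex.I)

lemma continuous_polarPt : Continuous fun x : ℝ × ℝ => polarPt x.1 x.2 := by
  unfold polarPt
  fun_prop

lemma norm_polarPt (t θ : ℝ) : ‖polarPt t θ‖ = |t| := by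
  simp [polarPt, Complex.norm_exp_ofReal_mul_I]

lemma hasDerivAt_normSq_comp {F : ℝ → ℂ} {F' : ℂ} {t : ℝ} (hF : HasDerivAt F F' t) :
    HasDerivAt (fun t => Complex.normSq (F t)) (2 * ((F t).re * F'.re + (F t).im * F'.im)) t := by
  have h1 : HasDerivAt (fun t => (F t).re) F'.re t :=
    Complex.reCLM.hasFDerivAt.comp_hasDerivAt t hF
  have h2 : HasDerivAt (fun t => (F t).im) F'.im t :=
    Complex.imCLM.hasFDerivAt.comp_hasDerivAt t hF
  simp only [Complex.normSq_apply]
  exact ((h1.mul h1).add (h2.mul h2)).congr_deriv (by ring)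

lemma hasDerivAt_radial {F G : ℝ → ℂ} {H : ℂ} {t : ℝ} {φ₁ φ₂ : ℝ → ℝ}
    (hF : HasDerivAt F (G t) t) (hG : HasDerivAt G H t)
    (hφ : HasDerivAt φ₁ (φ₂ (Complex.normSq (F t))) (Complex.normSq (F t))) :
    HasDerivAt
      (fun t => 2 * φ₁ (Complex.normSq (F t)) * ((F t).re * (G t).re + (F t).im * (G t).im))
      (4 * φ₂ (Complex.normSq (F t)) * ((F t).re * (G t).re + (F t).im * (G t).im) ^ 2 +
        2 * φ₁ (Complex.normSq (F t)) *
          (Complex.normSq (G t) + ((F t).re * H.re + (F t).im * H.im))) t := by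
  have h1 : HasDerivAt (fun t => (F t).re) (G t).re t :=
    Complex.reCLM.hasFDerivAt.comp_hasDerivAt t hF
  have h2 : HasDerivAt (fun t => (F t).im) (G t).im t :=
    Complex.imCLM.hasFDerivAt.comp_hasDerivAt t hF
  have h3 : HasDerivAt (fun t => (G t).re) H.re t :=
    Complex.reCLM.hasFDerivAt.comp_hasDerivAt t hG
  have h4 : HasDerivAt (fun t => (G t).im) H.im t :=
    Complex.imCLM.hasFDerivAt.comp_hasDerivAt t hG
  have h5 := (hφ.comp t (hasDerivAt_normSq_comp hF)).const_mul 2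
  refine (h5.mul ((h1.mul h3).add (h2.mul h4))).congr_deriv ?_
  simp only [Function.comp, Complex.normSq_apply, Pi.mul_apply, Pi.add_apply]
  ring

lemma hasDerivAt_angular {F G : ℝ → ℂ} {H : ℂ} {t θ : ℝ} {φ₁ φ₂ : ℝ → ℝ}
    (hF : HasDerivAt F (t * Complex.I * G θ) θ)
    (hG : HasDerivAt G (Complex.I * (G θ + t * H)) θ)
    (hφ : HasDerivAt φ₁ (φ₂ (Complex.normSq (F θ))) (Complex.normSq (F θ))) :
    HasDerivAt
      (fun θ => 2 * φ₁ (Complex.normSq (F θ)) * ((F θ).im * (G θ).re - (F θ).re * (G θ).im))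
      (t * (4 * φ₂ (Complex.normSq (F θ)) * Complex.normSq (F θ) * Complex.normSq (G θ) +
          4 * φ₁ (Complex.normSq (F θ)) * Complex.normSq (G θ)) -
        2 * φ₁ (Complex.normSq (F θ)) * ((F θ).re * (G θ).re + (F θ).im * (G θ).im) -
        t * (4 * φ₂ (Complex.normSq (F θ)) * ((F θ).re * (G θ).re + (F θ).im * (G θ).im) ^ 2 +
          2 * φ₁ (Complex.normSq (F θ)) *
            (Complex.normSq (G θ) + ((F θ).re * H.re + (F θ).im * H.im)))) θ := by
  have h1 : HasDerivAt (fun t => (F t).re) _ θ :=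
    Complex.reCLM.hasFDerivAt.comp_hasDerivAt θ hF
  have h2 : HasDerivAt (fun t => (F t).im) _ θ :=
    Complex.imCLM.hasFDerivAt.comp_hasDerivAt θ hF
  have h3 : HasDerivAt (fun t => (G t).re) _ θ :=
    Complex.reCLM.hasFDerivAt.comp_hasDerivAt θ hG
  have h4 : HasDerivAt (fun t => (G t).im) _ θ :=
    Complex.imCLM.hasFDerivAt.comp_hasDerivAt θ hG
  have h5 := (hφ.comp θ (hasDerivAt_normSq_comp hF)).const_mul 2
  refine (h5.mul ((h2.mul h3).sub (h1.mul h4))).congr_deriv ?_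
  simp only [Function.comp, Complex.normSq_apply, Pi.mul_apply, Pi.sub_apply, Complex.reCLM_apply,
    Complex.imCLM_apply, Complex.mul_re, Complex.mul_im, Complex.I_re, Complex.I_im,
    Complex.ofReal_re, Complex.ofReal_im, Complex.add_re, Complex.add_im]
  ring

lemma isOpen_unitDisc : IsOpen unitDisc := isOpen_lt continuous_norm continuous_const

lemma polarPt_mem_unitDisc {t : ℝ} (ht : |t| < 1) (θ : ℝ) : polarPt t θ ∈ unitDisc := by
  simpa [unitDisc, norm_polarPt] using ht

lemma hasDerivAt_polarPt_radial (t θ : ℝ) :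
    HasDerivAt (fun t => polarPt t θ) (Complex.exp (θ * Complex.I)) t := by
  exact ((Complex.ofRealCLM.hasDerivAt (x := t)).mul_const
    (Complex.exp (θ * Complex.I))).congr_deriv (by simp)

lemma hasDerivAt_exp_angle (θ : ℝ) :
    HasDerivAt (fun θ : ℝ => Complex.exp (θ * Complex.I))
      (Complex.I * Complex.exp (θ * Complex.I)) θ := by
  have h := ((Complex.ofRealCLM.hasDerivAt (x := θ)).mul_const Complex.I).cexp
  refine h.congr_deriv ?_
  simp [mul_comm]

lemma hasDerivAt_polarPt_angular (t θ : ℝ) :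
    HasDerivAt (fun θ => polarPt t θ) (t * Complex.I * Complex.exp (θ * Complex.I)) θ :=
  ((hasDerivAt_exp_angle θ).const_mul (t : ℂ)).congr_deriv (by ring)

/-- The Laplacian of `φ (|f|²)` for analytic `f`, given the first and second derivatives of `φ`. -/
def lapNormSq (f : ℂ → ℂ) (φ₁ φ₂ : ℝ → ℝ) (z : ℂ) : ℝ :=
  4 * φ₂ (Complex.normSq (f z)) * Complex.normSq (f z) * Complex.normSq (deriv f z) +
    4 * φ₁ (Complex.normSq (f z)) * Complex.normSq (deriv f z)

section
variable {f : ℂ → ℂ} {φ φ₁ φ₂ : ℝ → ℝ}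

/-- `φ₁(|f|²) ∂_r |f|²` in polar coordinates. -/
def radDer (f : ℂ → ℂ) (φ₁ : ℝ → ℝ) (t θ : ℝ) : ℝ :=
  2 * φ₁ (Complex.normSq (f (polarPt t θ))) *
    ((f (polarPt t θ)).re * (Complex.exp (θ * Complex.I) * deriv f (polarPt t θ)).re +
      (f (polarPt t θ)).im * (Complex.exp (θ * Complex.I) * deriv f (polarPt t θ)).im)

/-- The second radial derivative of `φ(|f|²)`. -/
def radDer₂ (f : ℂ → ℂ) (φ₁ φ₂ : ℝ → ℝ) (t θ : ℝ) : ℝ :=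
  4 * φ₂ (Complex.normSq (f (polarPt t θ))) *
    ((f (polarPt t θ)).re * (Complex.exp (θ * Complex.I) * deriv f (polarPt t θ)).re +
      (f (polarPt t θ)).im * (Complex.exp (θ * Complex.I) * deriv f (polarPt t θ)).im) ^ 2 +
  2 * φ₁ (Complex.normSq (f (polarPt t θ))) *
    (Complex.normSq (Complex.exp (θ * Complex.I) * deriv f (polarPt t θ)) +
      ((f (polarPt t θ)).re *
          (Complex.exp (θ * Complex.I) ^ 2 * deriv (deriv f) (polarPt t θ)).re +
        (f (polarPt t θ)).im *
          (Complex.exp (θ * Complex.I) ^ 2 * deriv (deriv f) (polarPt t θ)).im))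

lemma normSq_exp_mul (θ : ℝ) (w : ℂ) :
    Complex.normSq (Complex.exp (θ * Complex.I) * w) = Complex.normSq w := by
  rw [map_mul, Complex.normSq_eq_norm_sq (Complex.exp _), Complex.norm_exp_ofReal_mul_I]
  simp

lemma hasDerivAt_comp_radial {g : ℂ → ℂ} (hg : DifferentiableOn ℂ g unitDisc) {t : ℝ}
    (ht : |t| < 1) (θ : ℝ) :
    HasDerivAt (fun t => g (polarPt t θ))
      (Complex.exp (θ * Complex.I) * deriv g (polarPt t θ)) t := by
  have h := (hg.differentiableAt
    (isOpen_unitDisc.mem_nhds (polarPt_mem_unitDisc ht θ))).hasDerivAt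
  exact (h.comp t (hasDerivAt_polarPt_radial t θ)).congr_deriv (by ring)

lemma hasDerivAt_comp_angular {g : ℂ → ℂ} (hg : DifferentiableOn ℂ g unitDisc) {t : ℝ}
    (ht : |t| < 1) (θ : ℝ) :
    HasDerivAt (fun θ => g (polarPt t θ))
      (t * Complex.I * (Complex.exp (θ * Complex.I) * deriv g (polarPt t θ))) θ := by
  have h := (hg.differentiableAt
    (isOpen_unitDisc.mem_nhds (polarPt_mem_unitDisc ht θ))).hasDerivAt
  exact (h.comp θ (hasDerivAt_polarPt_angular t θ)).congr_deriv (by ring)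

lemma continuousOn_comp_polarPt {E : Type*} [TopologicalSpace E] {g : ℂ → E}
    (hg : ContinuousOn g unitDisc) :
    ContinuousOn (fun x : ℝ × ℝ => g (polarPt x.1 x.2)) {x | |x.1| < 1} :=
  hg.comp continuous_polarPt.continuousOn fun _ hx => polarPt_mem_unitDisc hx _

lemma hasDerivAt_phi (hf : DifferentiableOn ℂ f unitDisc)
    (hφ : ∀ x, 0 ≤ x → HasDerivAt φ (φ₁ x) x) {t : ℝ} (ht : |t| < 1) (θ : ℝ) :
    HasDerivAt (fun t => φ (Complex.normSq (f (polarPt t θ)))) (radDer f φ₁ t θ) t := by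
  refine ((hφ _ (Complex.normSq_nonneg _)).comp t
    (hasDerivAt_normSq_comp (hasDerivAt_comp_radial hf ht θ))).congr_deriv ?_
  simp only [radDer]
  ring

lemma hasDerivAt_radDer (hf : DifferentiableOn ℂ f unitDisc)
    (hφ : ∀ x, 0 ≤ x → HasDerivAt φ₁ (φ₂ x) x) {t : ℝ} (ht : |t| < 1) (θ : ℝ) :
    HasDerivAt (fun t => radDer f φ₁ t θ) (radDer₂ f φ₁ φ₂ t θ) t := by
  have h1 := ((hasDerivAt_comp_radial (hf.deriv isOpen_unitDisc) ht θ).const_mul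
    (Complex.exp (θ * Complex.I))).congr_deriv
      (g' := Complex.exp (θ * Complex.I) ^ 2 * deriv (deriv f) (polarPt t θ)) (by ring)
  exact hasDerivAt_radial (hasDerivAt_comp_radial hf ht θ) h1 (hφ _ (Complex.normSq_nonneg _))

lemma hasDerivAt_angDer (hf : DifferentiableOn ℂ f unitDisc)
    (hφ : ∀ x, 0 ≤ x → HasDerivAt φ₁ (φ₂ x) x) {t : ℝ} (ht : |t| < 1) (θ : ℝ) :
    HasDerivAt (fun θ => 2 * φ₁ (Complex.normSq (f (polarPt t θ))) *
        ((f (polarPt t θ)).im * (Complex.exp (θ * Complex.I) * deriv f (polarPt t θ)).re -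
          (f (polarPt t θ)).re * (Complex.exp (θ * Complex.I) * deriv f (polarPt t θ)).im))
      (t * lapNormSq f φ₁ φ₂ (polarPt t θ) - (radDer f φ₁ t θ + t * radDer₂ f φ₁ φ₂ t θ)) θ := by
  have h1 := ((hasDerivAt_exp_angle θ).mul
      (hasDerivAt_comp_angular (hf.deriv isOpen_unitDisc) ht θ)).congr_deriv
      (g' := Complex.I * (Complex.exp (θ * Complex.I) * deriv f (polarPt t θ) +
        t * (Complex.exp (θ * Complex.I) ^ 2 * deriv (deriv f) (polarPt t θ)))) (by ring)
  refine (hasDerivAt_angular (hasDerivAt_comp_angular hf ht θ) h1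
    (hφ _ (Complex.normSq_nonneg _))).congr_deriv ?_
  simp only [radDer, radDer₂, lapNormSq, Pi.mul_apply, normSq_exp_mul]
  ring

lemma continuousOn_radDer (hf : DifferentiableOn ℂ f unitDisc)
    (hφ₁ : ContinuousOn φ₁ (Ici 0)) :
    ContinuousOn (fun x : ℝ × ℝ => radDer f φ₁ x.1 x.2) {x | |x.1| < 1} := by
  have c0 := continuousOn_comp_polarPt hf.continuousOn
  have c1 := continuousOn_comp_polarPt (hf.deriv isOpen_unitDisc).continuousOn
  have cn := Complex.continuous_normSq.comp_continuousOn c0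
  have cφ := hφ₁.comp cn fun _ _ => Complex.normSq_nonneg _
  have ce : ContinuousOn (fun x : ℝ × ℝ => Complex.exp (x.2 * Complex.I)) {x | |x.1| < 1} := by
    fun_prop
  have c2 := ce.mul c1
  have r0 := Complex.continuous_re.comp_continuousOn c0
  have i0 := Complex.continuous_im.comp_continuousOn c0
  have r2 := Complex.continuous_re.comp_continuousOn c2
  have i2 := Complex.continuous_im.comp_continuousOn c2
  exact (continuousOn_const.mul cφ).mul ((r0.mul r2).add (i0.mul i2))

lemma continuousOn_lapNormSq (hf : DifferentiableOn ℂ f unitDisc)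
    (hφ₁ : ContinuousOn φ₁ (Ici 0)) (hφ₂ : ContinuousOn φ₂ (Ici 0)) :
    ContinuousOn (lapNormSq f φ₁ φ₂) unitDisc := by
  have cn := Complex.continuous_normSq.comp_continuousOn hf.continuousOn
  have cd := Complex.continuous_normSq.comp_continuousOn (hf.deriv isOpen_unitDisc).continuousOn
  have c1 := hφ₁.comp cn fun _ _ => Complex.normSq_nonneg _
  have c2 := hφ₂.comp cn fun _ _ => Complex.normSq_nonneg _
  exact (((continuousOn_const.mul c2).mul cn).mul cd).add ((continuousOn_const.mul c1).mul cd)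

lemma continuousOn_radDer₂ (hf : DifferentiableOn ℂ f unitDisc)
    (hφ₁ : ContinuousOn φ₁ (Ici 0)) (hφ₂ : ContinuousOn φ₂ (Ici 0)) :
    ContinuousOn (fun x : ℝ × ℝ => radDer₂ f φ₁ φ₂ x.1 x.2) {x | |x.1| < 1} := by
  have c0 := continuousOn_comp_polarPt hf.continuousOn
  have c1 := continuousOn_comp_polarPt (hf.deriv isOpen_unitDisc).continuousOn
  have c3 := continuousOn_comp_polarPt
    ((hf.deriv isOpen_unitDisc).deriv isOpen_unitDisc).continuousOn
  have cn := Complex.continuous_normSq.comp_continuousOn c0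
  have cφ := hφ₁.comp cn fun _ _ => Complex.normSq_nonneg _
  have cφ₂ := hφ₂.comp cn fun _ _ => Complex.normSq_nonneg _
  have ce : ContinuousOn (fun x : ℝ × ℝ => Complex.exp (x.2 * Complex.I)) {x | |x.1| < 1} := by
    fun_prop
  have c2 := ce.mul c1
  have c4 := (ce.pow 2).mul c3
  have r0 := Complex.continuous_re.comp_continuousOn c0
  have i0 := Complex.continuous_im.comp_continuousOn c0
  have r2 := Complex.continuous_re.comp_continuousOn c2
  have i2 := Complex.continuous_im.comp_continuousOn c2
  have r4 := Complex.continuous_re.comp_continuousOn c4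
  have i4 := Complex.continuous_im.comp_continuousOn c4
  have n2 := Complex.continuous_normSq.comp_continuousOn c2
  exact ((continuousOn_const.mul cφ₂).mul (((r0.mul r2).add (i0.mul i2)).pow 2)).add
    ((continuousOn_const.mul cφ).mul (n2.add ((r0.mul r4).add (i0.mul i4))))

end
section
variable {f : ℂ → ℂ} {φ φ₁ φ₂ : ℝ → ℝ}

lemma intervalIntegral_radial (hf : DifferentiableOn ℂ f unitDisc)
    (hφ : ∀ x, 0 ≤ x → HasDerivAt φ (φ₁ x) x) (hφ₁ : ∀ x, 0 ≤ x → HasDerivAt φ₁ (φ₂ x) x)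
    (hφ₂ : ContinuousOn φ₂ (Ici 0)) {s : ℝ} (hs0 : 0 < s) (hs1 : s < 1) (θ : ℝ) :
    ∫ t in (0:ℝ)..s, (radDer f φ₁ t θ + t * radDer₂ f φ₁ φ₂ t θ) * (Real.log s - Real.log t) =
      φ (Complex.normSq (f (polarPt s θ))) - φ (Complex.normSq (f 0)) := by
  have habs : ∀ t ∈ Icc 0 s, |t| < 1 := fun t ht => by
    rw [abs_of_nonneg ht.1]; exact ht.2.trans_lt hs1
  have hslice : ContinuousOn (fun t : ℝ => (t, θ)) (Icc 0 s) :=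
    (continuous_id.prodMk continuous_const).continuousOn
  have hmaps : MapsTo (fun t : ℝ => (t, θ)) (Icc 0 s) {x : ℝ × ℝ | |x.1| < 1} :=
    fun t ht => habs t ht
  have hφ₁' : ContinuousOn φ₁ (Ici 0) :=
    fun x hx => (hφ₁ x hx).continuousAt.continuousWithinAt
  have hc1 : ContinuousOn (fun t => radDer f φ₁ t θ) (Icc 0 s) := by
    have h := (continuousOn_radDer hf hφ₁').comp hslice hmaps
    exact h
  have hc2 : ContinuousOn (fun t => radDer₂ f φ₁ φ₂ t θ) (Icc 0 s) := by
    have h := (continuousOn_radDer₂ hf hφ₁' hφ₂).comp hslice hmaps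
    exact h
  have hc0 : ContinuousOn (fun t => φ (Complex.normSq (f (polarPt t θ)))) (Icc 0 s) :=
    fun t ht => (hasDerivAt_phi hf hφ (habs t ht) θ).continuousAt.continuousWithinAt
  have hcl : ContinuousOn (fun t : ℝ => t * Real.log s - t * Real.log t) (Icc 0 s) :=
    ((continuous_id.mul continuous_const).sub Real.continuous_mul_log).continuousOn
  have hcR : ContinuousOn (fun t => radDer f φ₁ t θ + t * radDer₂ f φ₁ φ₂ t θ) (Icc 0 s) :=
    hc1.add (continuousOn_id.mul hc2)
  have hmain := intervalIntegral.integral_eq_sub_of_hasDerivAt_of_le hs0.le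
    (f := fun t => radDer f φ₁ t θ * (t * Real.log s - t * Real.log t) +
      φ (Complex.normSq (f (polarPt t θ))))
    (f' := fun t => (radDer f φ₁ t θ + t * radDer₂ f φ₁ φ₂ t θ) * (Real.log s - Real.log t))
    ((hc1.mul hcl).add hc0) ?_ ?_
  · rw [hmain]
    simp [polarPt]
  · intro t ht
    have ht' := habs t (Ioo_subset_Icc_self ht)
    have h1 := hasDerivAt_radDer hf hφ₁ ht' θ
    have h2 := hasDerivAt_phi hf hφ ht' θ
    have h3 := ((hasDerivAt_id t).mul_const (Real.log s)).sub
      (Real.hasDerivAt_mul_log ht.1.ne')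
    refine ((h1.mul h3).add h2).congr_deriv ?_
    simp only [Pi.sub_apply, id]
    ring
  · refine IntervalIntegrable.continuousOn_mul ?_ ?_
    · exact intervalIntegrable_const.sub intervalIntegral.intervalIntegrable_log'
    · rw [uIcc_of_le hs0.le]
      exact hcR

lemma integral_angular (hf : DifferentiableOn ℂ f unitDisc)
    (hφ₁ : ∀ x, 0 ≤ x → HasDerivAt φ₁ (φ₂ x) x)
    (hφ₂ : ContinuousOn φ₂ (Ici 0)) {t : ℝ} (ht : |t| < 1) :
    ∫ θ in Ioo (-Real.pi) Real.pi, (radDer f φ₁ t θ + t * radDer₂ f φ₁ φ₂ t θ) =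
      t * ∫ θ in Ioo (-Real.pi) Real.pi, lapNormSq f φ₁ φ₂ (polarPt t θ) := by
  have hφ₁' : ContinuousOn φ₁ (Ici 0) :=
    fun x hx => (hφ₁ x hx).continuousAt.continuousWithinAt
  have hslice : Continuous (fun θ : ℝ => (t, θ)) := by fun_prop
  have hc1 : Continuous (fun θ => radDer f φ₁ t θ) :=
    (continuousOn_radDer hf hφ₁').comp_continuous hslice fun _ => ht
  have hc2 : Continuous (fun θ => radDer₂ f φ₁ φ₂ t θ) :=
    (continuousOn_radDer₂ hf hφ₁' hφ₂).comp_continuous hslice fun _ => ht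
  have hc3 : Continuous (fun θ => lapNormSq f φ₁ φ₂ (polarPt t θ)) :=
    (continuousOn_comp_polarPt (continuousOn_lapNormSq hf hφ₁' hφ₂)).comp_continuous hslice
      fun _ => ht
  have hc4 : Continuous fun θ => radDer f φ₁ t θ + t * radDer₂ f φ₁ φ₂ t θ :=
    hc1.add (continuous_const.mul hc2)
  have hc5 : Continuous fun θ => t * lapNormSq f φ₁ φ₂ (polarPt t θ) := continuous_const.mul hc3
  have h := intervalIntegral.integral_eq_sub_of_hasDerivAt (a := -Real.pi) (b := Real.pi)
    (fun θ _ => hasDerivAt_angDer hf hφ₁ ht θ)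
    ((hc5.sub hc4).intervalIntegrable _ _)
  have hper : polarPt t (-Real.pi) = polarPt t Real.pi := by
    simp [polarPt, Complex.exp_neg]
  have hexp : Complex.exp ((-Real.pi : ℝ) * Complex.I) = Complex.exp ((Real.pi : ℝ) * Complex.I) := by
    simp [Complex.exp_neg]
  rw [hper, hexp, sub_self, intervalIntegral.integral_sub
    (hc5.intervalIntegrable _ _) (hc4.intervalIntegrable _ _),
    intervalIntegral.integral_const_mul, sub_eq_zero,
    intervalIntegral.integral_of_le (by linarith [Real.pi_pos]),
    intervalIntegral.integral_of_le (by linarith [Real.pi_pos]),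
    integral_Ioc_eq_integral_Ioo, integral_Ioc_eq_integral_Ioo] at h
  exact h.symm

lemma integrable_mul_log_prod {R : ℝ × ℝ → ℝ} (hR : ContinuousOn R {x | |x.1| < 1})
    {s : ℝ} (hs0 : 0 < s) (hs1 : s < 1) :
    Integrable (fun x => R x * (Real.log s - Real.log x.1))
      ((volume.restrict (Ioo 0 s)).prod (volume.restrict (Ioo (-Real.pi) Real.pi))) := by
  have hL : IntegrableOn (fun t => Real.log s - Real.log t) (Ioo 0 s) := by
    rw [← intervalIntegrable_iff_integrableOn_Ioo_of_le hs0.le]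
    exact intervalIntegrable_const.sub intervalIntegral.intervalIntegrable_log'
  have hsub : Icc 0 s ×ˢ Icc (-Real.pi) Real.pi ⊆ {x : ℝ × ℝ | |x.1| < 1} := by
    intro x hx
    show |x.1| < 1
    rw [abs_of_nonneg hx.1.1]
    exact hx.1.2.trans_lt hs1
  have hsub' : Ioo 0 s ×ˢ Ioo (-Real.pi) Real.pi ⊆ Icc 0 s ×ˢ Icc (-Real.pi) Real.pi :=
    prod_mono Ioo_subset_Icc_self Ioo_subset_Icc_self
  obtain ⟨C, hC⟩ := (isCompact_Icc.prod isCompact_Icc).exists_bound_of_continuousOn (hR.mono hsub)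
  refine Integrable.bdd_mul (c := C)
    (Integrable.comp_fst hL (volume.restrict (Ioo (-Real.pi) Real.pi))) ?_ ?_
  · rw [Measure.prod_restrict]
    exact ((hR.mono hsub).mono hsub').aestronglyMeasurable (measurableSet_Ioo.prod measurableSet_Ioo)
  · rw [Measure.prod_restrict]
    filter_upwards [ae_restrict_mem (measurableSet_Ioo.prod measurableSet_Ioo)] with x hx
    exact hC x (hsub' hx)

theorem lintegral_circle_eq (hf : DifferentiableOn ℂ f unitDisc)
    (hφ : ∀ x, 0 ≤ x → HasDerivAt φ (φ₁ x) x) (hφ₁ : ∀ x, 0 ≤ x → HasDerivAt φ₁ (φ₂ x) x)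
    (hφ₂ : ContinuousOn φ₂ (Ici 0)) (hφ0 : ∀ x, 0 ≤ x → 0 ≤ φ x)
    (hlap : ∀ z, 0 ≤ lapNormSq f φ₁ φ₂ z)
    {s : ℝ} (hs0 : 0 < s) (hs1 : s < 1) :
    ∫⁻ θ in Ioo (-Real.pi) Real.pi, ENNReal.ofReal (φ (Complex.normSq (f (polarPt s θ)))) =
      ∫⁻ x, ENNReal.ofReal
          (x.1 * (Real.log s - Real.log x.1) * lapNormSq f φ₁ φ₂ (polarPt x.1 x.2))
        ∂((volume.restrict (Ioo 0 s)).prod (volume.restrict (Ioo (-Real.pi) Real.pi))) +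
      ENNReal.ofReal (2 * Real.pi) * ENNReal.ofReal (φ (Complex.normSq (f 0))) := by
  have hφ₁' : ContinuousOn φ₁ (Ici 0) :=
    fun x hx => (hφ₁ x hx).continuousAt.continuousWithinAt
  have hφ' : ContinuousOn φ (Ici 0) :=
    fun x hx => (hφ x hx).continuousAt.continuousWithinAt
  have hfst : ContinuousOn (fun x : ℝ × ℝ => x.1) {x | |x.1| < 1} := by fun_prop
  have hI := integrable_mul_log_prod ((continuousOn_radDer hf hφ₁').add
    (hfst.mul (continuousOn_radDer₂ hf hφ₁' hφ₂))) hs0 hs1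
  have hK := integrable_mul_log_prod
    (hfst.mul (continuousOn_comp_polarPt (continuousOn_lapNormSq hf hφ₁' hφ₂))) hs0 hs1
  have hK' : Integrable (fun x : ℝ × ℝ =>
      x.1 * (Real.log s - Real.log x.1) * lapNormSq f φ₁ φ₂ (polarPt x.1 x.2))
      ((volume.restrict (Ioo 0 s)).prod (volume.restrict (Ioo (-Real.pi) Real.pi))) := by
    refine hK.congr (Eventually.of_forall fun x => ?_)
    simp only [Pi.mul_apply]
    ring
  have hs : |s| < 1 := by rwa [abs_of_pos hs0]
  have hcU : Continuous fun θ => φ (Complex.normSq (f (polarPt s θ))) := by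
    have h1 : Continuous fun θ => f (polarPt s θ) :=
      (continuousOn_comp_polarPt hf.continuousOn).comp_continuous
        (by fun_prop : Continuous (fun θ : ℝ => (s, θ))) fun _ => hs
    exact hφ'.comp_continuous (Complex.continuous_normSq.comp h1) fun _ => Complex.normSq_nonneg _
  have hiU : Integrable (fun θ => φ (Complex.normSq (f (polarPt s θ))))
      (volume.restrict (Ioo (-Real.pi) Real.pi)) :=
    (hcU.integrableOn_Icc (a := -Real.pi) (b := Real.pi)).mono_set Ioo_subset_Icc_self
  have hkey : ∫ θ in Ioo (-Real.pi) Real.pi, φ (Complex.normSq (f (polarPt s θ))) =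
      ∫ x, x.1 * (Real.log s - Real.log x.1) * lapNormSq f φ₁ φ₂ (polarPt x.1 x.2)
        ∂((volume.restrict (Ioo 0 s)).prod (volume.restrict (Ioo (-Real.pi) Real.pi))) +
      2 * Real.pi * φ (Complex.normSq (f 0)) := by
    rw [← sub_eq_iff_eq_add]
    have hconst : ∫ _ in Ioo (-Real.pi) Real.pi, φ (Complex.normSq (f 0)) =
        2 * Real.pi * φ (Complex.normSq (f 0)) := by
      rw [setIntegral_const]
      simp only [measureReal_def, Real.volume_Ioo, smul_eq_mul]
      rw [ENNReal.toReal_ofReal (by linarith [Real.pi_pos])]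
      ring
    rw [← hconst, ← integral_sub hiU (integrable_const _), integral_prod _ hK']
    have h1 : ∀ θ, φ (Complex.normSq (f (polarPt s θ))) - φ (Complex.normSq (f 0)) =
        ∫ t in Ioo 0 s,
          (radDer f φ₁ t θ + t * radDer₂ f φ₁ φ₂ t θ) * (Real.log s - Real.log t) := fun θ => by
      rw [← intervalIntegral_radial hf hφ hφ₁ hφ₂ hs0 hs1 θ, intervalIntegral.integral_of_le hs0.le,
        integral_Ioc_eq_integral_Ioo]
    simp_rw [h1]
    rw [← integral_integral_swap (f := fun t θ =>
      (radDer f φ₁ t θ + t * radDer₂ f φ₁ φ₂ t θ) * (Real.log s - Real.log t)) hI]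
    refine setIntegral_congr_fun measurableSet_Ioo fun t ht => ?_
    rw [integral_mul_const, integral_const_mul, integral_angular hf hφ₁ hφ₂
      (by rw [abs_of_pos ht.1]; exact ht.2.trans hs1)]
    ring
  have hnonneg : 0 ≤ᵐ[(volume.restrict (Ioo 0 s)).prod (volume.restrict (Ioo (-Real.pi) Real.pi))]
      fun x : ℝ × ℝ =>
        x.1 * (Real.log s - Real.log x.1) * lapNormSq f φ₁ φ₂ (polarPt x.1 x.2) := by
    rw [Measure.prod_restrict]
    filter_upwards [ae_restrict_mem (measurableSet_Ioo.prod measurableSet_Ioo)] with x hx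
    have := Real.log_le_log hx.1.1 hx.1.2.le
    exact mul_nonneg (mul_nonneg hx.1.1.le (by linarith)) (hlap _)
  rw [← ofReal_integral_eq_lintegral_ofReal hiU
    (Eventually.of_forall fun θ => hφ0 _ (Complex.normSq_nonneg _)),
    ← ofReal_integral_eq_lintegral_ofReal hK' hnonneg, hkey,
    ENNReal.ofReal_add (integral_nonneg_of_ae hnonneg)
      (mul_nonneg (by positivity) (hφ0 _ (Complex.normSq_nonneg _))),
    ENNReal.ofReal_mul (by positivity)]

end
lemma ae_polar_of_ae {S : Set ℂ} (hS : MeasurableSet S) (h0 : volume S = 0) {s : ℝ} :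
    ∀ᵐ x ∂((volume.restrict (Ioo 0 s)).prod (volume.restrict (Ioo (-Real.pi) Real.pi))),
      polarPt x.1 x.2 ∉ S := by
  have h := Complex.lintegral_comp_polarCoord_symm (S.indicator 1)
  rw [lintegral_indicator_one hS, h0, lintegral_eq_zero_iff
    (by
      have : Measurable fun x : ℝ × ℝ => polarPt x.1 x.2 := continuous_polarPt.measurable
      have h1 : (fun p : ℝ × ℝ => ENNReal.ofReal p.1 •
          S.indicator (1 : ℂ → ENNReal) (Complex.polarCoord.symm p)) =
          fun p => ENNReal.ofReal p.1 * S.indicator 1 (polarPt p.1 p.2) := by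
        ext p
        simp [polarPt, Complex.polarCoord_symm_apply, Complex.exp_mul_I]
      rw [h1]
      exact measurable_fst.ennreal_ofReal.mul ((measurable_one.indicator hS).comp this))] at h
  rw [Measure.prod_restrict]
  have hsub : Ioo 0 s ×ˢ Ioo (-Real.pi) Real.pi ⊆ polarCoord.target := by
    rw [polarCoord_target]
    exact prod_mono Ioo_subset_Ioi_self subset_rfl
  have h2 := ae_restrict_of_ae_restrict_of_subset (μ := volume) hsub h
  rw [← Measure.volume_eq_prod]
  filter_upwards [h2, ae_restrict_mem (measurableSet_Ioo.prod measurableSet_Ioo)] with x hx hx'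
  intro hxS
  have h3 : Complex.polarCoord.symm x = polarPt x.1 x.2 := by
    simp [polarPt, Complex.polarCoord_symm_apply, Complex.exp_mul_I]
  have hpos : 0 < x.1 := hx'.1.1
  simp [h3, hxS] at hx
  linarith

lemma countable_simple_zeros {f : ℂ → ℂ} (hf : DifferentiableOn ℂ f unitDisc) :
    {z ∈ unitDisc | f z = 0 ∧ deriv f z ≠ 0}.Countable := by
  refine (HereditarilyLindelofSpace.isLindelof _).countable_of_isDiscrete ?_
  rw [isDiscrete_iff_nhdsNE]
  rintro z ⟨hz, hz0, hz1⟩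
  have h := ((hf.differentiableAt (isOpen_unitDisc.mem_nhds hz)).hasDerivAt).eventually_ne
    (c := 0) hz1
  rw [← disjoint_iff, Filter.disjoint_principal_right]
  filter_upwards [h] with w hw hw'
  exact hw hw'.2.1

lemma ae_deriv_eq_zero_of_eq_zero {f : ℂ → ℂ} (hf : DifferentiableOn ℂ f unitDisc)
    {s : ℝ} (hs1 : s < 1) :
    ∀ᵐ x ∂((volume.restrict (Ioo 0 s)).prod (volume.restrict (Ioo (-Real.pi) Real.pi))),
      f (polarPt x.1 x.2) = 0 → deriv f (polarPt x.1 x.2) = 0 := by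
  have hc := countable_simple_zeros hf
  have h := ae_polar_of_ae hc.measurableSet (hc.measure_zero volume) (s := s)
  rw [Measure.prod_restrict] at h ⊢
  filter_upwards [h, ae_restrict_mem (measurableSet_Ioo.prod measurableSet_Ioo)] with x hx hx' h0
  by_contra h1
  refine hx ⟨polarPt_mem_unitDisc ?_ _, h0, h1⟩
  rw [abs_of_pos hx'.1.1]
  exact hx'.1.2.trans hs1

/-- The Laplacian of `(|f|² + ε) ^ q`. -/
def lapReg (f : ℂ → ℂ) (q ε : ℝ) : ℂ → ℝ :=
  lapNormSq f (fun x => q * (x + ε) ^ (q - 1)) (fun x => q * ((q - 1) * (x + ε) ^ (q - 2)))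

section
variable {f : ℂ → ℂ} {q ε : ℝ}

lemma lapReg_eq (hε : 0 < ε) (z : ℂ) :
    lapReg f q ε z = 4 * q * Complex.normSq (deriv f z) *
      ((Complex.normSq (f z) + ε) ^ (q - 2) * (q * Complex.normSq (f z) + ε)) := by
  have h : 0 < Complex.normSq (f z) + ε := by linarith [Complex.normSq_nonneg (f z)]
  have h1 : (Complex.normSq (f z) + ε) ^ (q - 1) =
      (Complex.normSq (f z) + ε) ^ (q - 2) * (Complex.normSq (f z) + ε) := by
    rw [← Real.rpow_add_one h.ne']
    ring_nf
  simp only [lapReg, lapNormSq, h1]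
  ring

lemma lapReg_nonneg (hq : 0 < q) (hε : 0 < ε) (z : ℂ) : 0 ≤ lapReg f q ε z := by
  rw [lapReg_eq hε]
  have := Complex.normSq_nonneg (f z)
  have := Complex.normSq_nonneg (deriv f z)
  positivity

lemma continuousOn_add_rpow (hε : 0 < ε) (r : ℝ) :
    ContinuousOn (fun x : ℝ => (x + ε) ^ r) (Ici 0) := by
  refine ContinuousOn.rpow_const (by fun_prop) fun x hx => Or.inl ?_
  have : 0 ≤ x := hx
  positivity

lemma hasDerivAt_add_rpow (hε : 0 < ε) (r : ℝ) {x : ℝ} (hx : 0 ≤ x) :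
    HasDerivAt (fun x : ℝ => (x + ε) ^ r) (r * (x + ε) ^ (r - 1)) x := by
  have h := ((hasDerivAt_id x).add_const ε).rpow_const (p := r)
    (Or.inl (show id x + ε ≠ 0 by simp only [id]; positivity))
  exact h.congr_deriv (by simp)

lemma continuousOn_lapReg (hf : DifferentiableOn ℂ f unitDisc) (hε : 0 < ε) :
    ContinuousOn (lapReg f q ε) unitDisc :=
  continuousOn_lapNormSq hf (continuousOn_const.mul (continuousOn_add_rpow hε _))
    (continuousOn_const.mul (continuousOn_const.mul (continuousOn_add_rpow hε _)))

lemma lintegral_circle_reg (hf : DifferentiableOn ℂ f unitDisc) (hq : 0 < q) (hε : 0 < ε)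
    {s : ℝ} (hs0 : 0 < s) (hs1 : s < 1) :
    ∫⁻ θ in Ioo (-Real.pi) Real.pi,
        ENNReal.ofReal ((Complex.normSq (f (polarPt s θ)) + ε) ^ q) =
      ∫⁻ x, ENNReal.ofReal
          (x.1 * (Real.log s - Real.log x.1) * lapReg f q ε (polarPt x.1 x.2))
        ∂((volume.restrict (Ioo 0 s)).prod (volume.restrict (Ioo (-Real.pi) Real.pi))) +
      ENNReal.ofReal (2 * Real.pi) * ENNReal.ofReal ((Complex.normSq (f 0) + ε) ^ q) := by
  refine lintegral_circle_eq (φ := fun x => (x + ε) ^ q)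
    (φ₁ := fun x => q * (x + ε) ^ (q - 1))
    (φ₂ := fun x => q * ((q - 1) * (x + ε) ^ (q - 2))) hf
    (fun x hx => hasDerivAt_add_rpow hε q hx) (fun x hx => ?_)
    (continuousOn_const.mul (continuousOn_const.mul (continuousOn_add_rpow hε _)))
    (fun x hx => by positivity) (lapReg_nonneg hq hε) hs0 hs1
  refine ((hasDerivAt_add_rpow hε (q - 1) hx).const_mul q).congr_deriv ?_
  ring_nf

lemma lapReg_le_of_le_one (hq : 0 < q) (hq1 : q ≤ 1) (hε : 0 < ε) {z : ℂ}
    (hz : f z = 0 → deriv f z = 0) :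
    lapReg f q ε z ≤
      q⁻¹ * (4 * q ^ 2 * (Complex.normSq (f z) ^ (q - 1) * Complex.normSq (deriv f z))) := by
  rw [lapReg_eq hε]
  by_cases h0 : f z = 0
  · simp [hz h0]
  have hn : 0 < Complex.normSq (f z) := Complex.normSq_pos.mpr h0
  have hd := Complex.normSq_nonneg (deriv f z)
  have h1 : (Complex.normSq (f z) + ε) ^ (q - 2) * (q * Complex.normSq (f z) + ε) ≤
      Complex.normSq (f z) ^ (q - 1) := by
    calc _ ≤ (Complex.normSq (f z) + ε) ^ (q - 2) * (Complex.normSq (f z) + ε) := by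
          gcongr
          nlinarith
      _ = (Complex.normSq (f z) + ε) ^ (q - 1) := by
          rw [← Real.rpow_add_one (by positivity)]
          ring_nf
      _ ≤ _ := Real.rpow_le_rpow_of_nonpos hn (by linarith) (by linarith)
  calc _ ≤ 4 * q * Complex.normSq (deriv f z) * Complex.normSq (f z) ^ (q - 1) := by gcongr
    _ = _ := by field_simp

lemma lapReg_le_of_one_le (hq1 : 1 ≤ q) (hε : 0 < ε) (hε1 : ε ≤ 1) (z : ℂ) :
    lapReg f q ε z ≤ q * lapReg f q 1 z := by
  rw [lapReg_eq hε, lapReg_eq one_pos]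
  have hn : 0 ≤ Complex.normSq (f z) := Complex.normSq_nonneg _
  have hd := Complex.normSq_nonneg (deriv f z)
  have hq : 0 < q := by linarith
  have h1 : (Complex.normSq (f z) + ε) ^ (q - 2) * (q * Complex.normSq (f z) + ε) ≤
      q * ((Complex.normSq (f z) + 1) ^ (q - 2) * (q * Complex.normSq (f z) + 1)) := by
    calc _ ≤ (Complex.normSq (f z) + ε) ^ (q - 2) * (q * (Complex.normSq (f z) + ε)) := by
          gcongr
          nlinarith
      _ = q * (Complex.normSq (f z) + ε) ^ (q - 1) := by
          have : (Complex.normSq (f z) + ε) ^ (q - 1) =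
              (Complex.normSq (f z) + ε) ^ (q - 2) * (Complex.normSq (f z) + ε) := by
            rw [← Real.rpow_add_one (by positivity)]
            ring_nf
          rw [this]
          ring
      _ ≤ q * (Complex.normSq (f z) + 1) ^ (q - 1) := by
          gcongr
      _ = q * ((Complex.normSq (f z) + 1) ^ (q - 2) * (Complex.normSq (f z) + 1)) := by
          rw [← Real.rpow_add_one (by positivity)]
          ring_nf
      _ ≤ _ := by
          gcongr
          nlinarith
  calc _ ≤ 4 * q * Complex.normSq (deriv f z) *
        (q * ((Complex.normSq (f z) + 1) ^ (q - 2) * (q * Complex.normSq (f z) + 1))) := by gcongr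
    _ = _ := by ring

lemma tendsto_lapReg {ε : ℕ → ℝ} (hε : ∀ n, 0 < ε n) (hlim : Tendsto ε atTop (nhds 0)) {z : ℂ}
    (hz : f z = 0 → deriv f z = 0) :
    Tendsto (fun n => lapReg f q (ε n) z) atTop
      (nhds (4 * q ^ 2 * (Complex.normSq (f z) ^ (q - 1) * Complex.normSq (deriv f z)))) := by
  simp_rw [fun n => lapReg_eq (f := f) (q := q) (hε n) z]
  by_cases h0 : f z = 0
  · simp [hz h0]
  have hn : 0 < Complex.normSq (f z) := Complex.normSq_pos.mpr h0
  have hadd : Tendsto (fun n => Complex.normSq (f z) + ε n) atTop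
      (nhds (Complex.normSq (f z))) := by
    simpa using hlim.const_add (Complex.normSq (f z))
  have h1 := hadd.rpow_const (p := q - 2) (Or.inl hn.ne')
  have h2 : Tendsto (fun n => q * Complex.normSq (f z) + ε n) atTop
      (nhds (q * Complex.normSq (f z))) := by
    simpa using hlim.const_add (q * Complex.normSq (f z))
  have h3 := (h1.mul h2).const_mul (4 * q * Complex.normSq (deriv f z))
  have h4 : Complex.normSq (f z) ^ (q - 1) =
      Complex.normSq (f z) ^ (q - 2) * Complex.normSq (f z) := by
    rw [← Real.rpow_add_one hn.ne']
    ring_nf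
  convert h3 using 2
  rw [h4]
  ring

end
section
variable {f : ℂ → ℂ} {q : ℝ}

theorem lintegral_circle_rpow_normSq (hf : DifferentiableOn ℂ f unitDisc) (hq : 0 < q)
    {s : ℝ} (hs0 : 0 < s) (hs1 : s < 1) :
    ∫⁻ θ in Ioo (-Real.pi) Real.pi, ENNReal.ofReal (Complex.normSq (f (polarPt s θ)) ^ q) =
      ∫⁻ x, ENNReal.ofReal (x.1 * (Real.log s - Real.log x.1) *
          (4 * q ^ 2 * (Complex.normSq (f (polarPt x.1 x.2)) ^ (q - 1) *
            Complex.normSq (deriv f (polarPt x.1 x.2)))))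
        ∂((volume.restrict (Ioo 0 s)).prod (volume.restrict (Ioo (-Real.pi) Real.pi))) +
      ENNReal.ofReal (2 * Real.pi) * ENNReal.ofReal (Complex.normSq (f 0) ^ q) := by
  set μ := (volume.restrict (Ioo 0 s)).prod (volume.restrict (Ioo (-Real.pi) Real.pi)) with hμ
  set ν := volume.restrict (Ioo (-Real.pi) Real.pi) with hν
  let ε : ℕ → ℝ := fun n => 1 / ((n : ℝ) + 1)
  have hε : ∀ n, 0 < ε n := fun n => by positivity
  have hε1 : ∀ n, ε n ≤ 1 := fun n => by
    rw [div_le_one (by positivity)]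
    linarith [(Nat.cast_nonneg n : (0:ℝ) ≤ n)]
  have hlim : Tendsto ε atTop (nhds 0) := tendsto_one_div_add_atTop_nhds_zero_nat
  have hadd : ∀ w : ℂ, Tendsto (fun n => ENNReal.ofReal ((Complex.normSq w + ε n) ^ q)) atTop
      (nhds (ENNReal.ofReal (Complex.normSq w ^ q))) := fun w => by
    have h1 : Tendsto (fun n => Complex.normSq w + ε n) atTop (nhds (Complex.normSq w)) := by
      simpa using hlim.const_add (Complex.normSq w)
    exact ENNReal.tendsto_ofReal (h1.rpow_const (Or.inr hq.le))
  have hs : |s| < 1 := by rwa [abs_of_pos hs0]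
  have hcf : Continuous fun θ => f (polarPt s θ) := by
    have h := (continuousOn_comp_polarPt hf.continuousOn).comp_continuous
      (by fun_prop : Continuous (fun θ : ℝ => (s, θ))) fun _ => hs
    exact h
  have hcU : ∀ e, 0 < e → Continuous fun θ => (Complex.normSq (f (polarPt s θ)) + e) ^ q :=
    fun e he => (((Complex.continuous_normSq.comp hcf).add continuous_const).rpow_const
      fun _ => Or.inr hq.le)
  have hfin : ∫⁻ θ, ENNReal.ofReal ((Complex.normSq (f (polarPt s θ)) + 1) ^ q) ∂ν ≠ ⊤ := by
    have hi : Integrable (fun θ => (Complex.normSq (f (polarPt s θ)) + 1) ^ q) ν :=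
      ((hcU 1 one_pos).integrableOn_Icc (a := -Real.pi) (b := Real.pi)).mono_set
        Ioo_subset_Icc_self
    exact hi.lintegral_lt_top.ne
  have hA : Tendsto (fun n => ∫⁻ θ, ENNReal.ofReal ((Complex.normSq (f (polarPt s θ)) + ε n) ^ q) ∂ν)
      atTop (nhds (∫⁻ θ, ENNReal.ofReal (Complex.normSq (f (polarPt s θ)) ^ q) ∂ν)) := by
    refine tendsto_lintegral_of_dominated_convergence
      (fun θ => ENNReal.ofReal ((Complex.normSq (f (polarPt s θ)) + 1) ^ q))
      (fun n => (hcU _ (hε n)).measurable.ennreal_ofReal) (fun n => ?_) hfin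
      (Eventually.of_forall fun θ => hadd _)
    refine Eventually.of_forall fun θ => ENNReal.ofReal_le_ofReal ?_
    have h0 := Complex.normSq_nonneg (f (polarPt s θ))
    have h1 := hε n
    have h2 := hε1 n
    gcongr
  have hAfin : ∫⁻ θ, ENNReal.ofReal (Complex.normSq (f (polarPt s θ)) ^ q) ∂ν ≠ ⊤ := by
    refine ne_top_of_le_ne_top hfin (lintegral_mono fun θ => ENNReal.ofReal_le_ofReal ?_)
    have h0 := Complex.normSq_nonneg (f (polarPt s θ))
    gcongr
    linarith
  have hC := ENNReal.Tendsto.const_mul (a := ENNReal.ofReal (2 * Real.pi)) (hadd (f 0))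
    (Or.inr ENNReal.ofReal_ne_top)
  have hdom : ∀ᵐ x ∂μ, x ∈ Ioo 0 s ×ˢ Ioo (-Real.pi) Real.pi := by
    rw [hμ, Measure.prod_restrict]
    exact ae_restrict_mem (measurableSet_Ioo.prod measurableSet_Ioo)
  have hK : ∀ᵐ x ∂μ, 0 ≤ x.1 * (Real.log s - Real.log x.1) := by
    filter_upwards [hdom] with x hx
    have := Real.log_le_log hx.1.1 hx.1.2.le
    exact mul_nonneg hx.1.1.le (by linarith)
  have hKm : Measurable fun x : ℝ × ℝ => x.1 * (Real.log s - Real.log x.1) := by fun_prop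
  have hz := ae_deriv_eq_zero_of_eq_zero hf hs1
  have hBm : ∀ n, AEMeasurable (fun x : ℝ × ℝ => ENNReal.ofReal
      (x.1 * (Real.log s - Real.log x.1) * lapReg f q (ε n) (polarPt x.1 x.2))) μ := fun n => by
    refine (hKm.aemeasurable.mul ?_).ennreal_ofReal
    rw [hμ, Measure.prod_restrict]
    refine ((continuousOn_comp_polarPt (continuousOn_lapReg hf (hε n))).mono ?_).aemeasurable
      (measurableSet_Ioo.prod measurableSet_Ioo)
    intro x hx
    show |x.1| < 1
    rw [abs_of_pos hx.1.1]
    exact hx.1.2.trans hs1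
  have hBlim : ∀ᵐ x ∂μ, Tendsto (fun n => ENNReal.ofReal
      (x.1 * (Real.log s - Real.log x.1) * lapReg f q (ε n) (polarPt x.1 x.2))) atTop
      (nhds (ENNReal.ofReal (x.1 * (Real.log s - Real.log x.1) *
          (4 * q ^ 2 * (Complex.normSq (f (polarPt x.1 x.2)) ^ (q - 1) *
            Complex.normSq (deriv f (polarPt x.1 x.2))))))) := by
    filter_upwards [hz] with x hx
    exact ENNReal.tendsto_ofReal ((tendsto_lapReg hε hlim hx).const_mul _)
  have hEq := fun n => lintegral_circle_reg hf hq (hε n) hs0 hs1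
  have hGfin : ∫⁻ x, ENNReal.ofReal (x.1 * (Real.log s - Real.log x.1) *
          (4 * q ^ 2 * (Complex.normSq (f (polarPt x.1 x.2)) ^ (q - 1) *
            Complex.normSq (deriv f (polarPt x.1 x.2))))) ∂μ ≠ ⊤ := by
    refine ne_top_of_le_ne_top hAfin ?_
    calc _ = ∫⁻ x, liminf (fun n => ENNReal.ofReal
          (x.1 * (Real.log s - Real.log x.1) * lapReg f q (ε n) (polarPt x.1 x.2))) atTop ∂μ :=
          lintegral_congr_ae (hBlim.mono fun x hx => hx.liminf_eq.symm)
      _ ≤ liminf (fun n => ∫⁻ x, ENNReal.ofReal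
          (x.1 * (Real.log s - Real.log x.1) * lapReg f q (ε n) (polarPt x.1 x.2)) ∂μ) atTop :=
          lintegral_liminf_le' hBm
      _ ≤ liminf (fun n => ∫⁻ θ, ENNReal.ofReal
          ((Complex.normSq (f (polarPt s θ)) + ε n) ^ q) ∂ν) atTop :=
          liminf_le_liminf (Eventually.of_forall fun n => by
            rw [hEq n]
            exact le_self_add)
      _ = _ := hA.liminf_eq
  have hB : Tendsto (fun n => ∫⁻ x, ENNReal.ofReal
      (x.1 * (Real.log s - Real.log x.1) * lapReg f q (ε n) (polarPt x.1 x.2)) ∂μ) atTop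
      (nhds (∫⁻ x, ENNReal.ofReal (x.1 * (Real.log s - Real.log x.1) *
          (4 * q ^ 2 * (Complex.normSq (f (polarPt x.1 x.2)) ^ (q - 1) *
            Complex.normSq (deriv f (polarPt x.1 x.2))))) ∂μ)) := by
    rcases le_total q 1 with hq1 | hq1
    · refine tendsto_lintegral_of_dominated_convergence'
        (fun x => ENNReal.ofReal q⁻¹ * ENNReal.ofReal (x.1 * (Real.log s - Real.log x.1) *
          (4 * q ^ 2 * (Complex.normSq (f (polarPt x.1 x.2)) ^ (q - 1) *
            Complex.normSq (deriv f (polarPt x.1 x.2))))))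
        hBm (fun n => ?_) ?_ hBlim
      · filter_upwards [hz, hK] with x hx hKx
        rw [← ENNReal.ofReal_mul (by positivity)]
        refine ENNReal.ofReal_le_ofReal ?_
        calc _ ≤ _ := mul_le_mul_of_nonneg_left (lapReg_le_of_le_one hq hq1 (hε n) hx) hKx
          _ = _ := by ring
      · rw [lintegral_const_mul' _ _ ENNReal.ofReal_ne_top]
        exact ENNReal.mul_ne_top ENNReal.ofReal_ne_top hGfin
    · refine tendsto_lintegral_of_dominated_convergence'
        (fun x => ENNReal.ofReal q * ENNReal.ofReal
          (x.1 * (Real.log s - Real.log x.1) * lapReg f q 1 (polarPt x.1 x.2)))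
        hBm (fun n => ?_) ?_ hBlim
      · filter_upwards [hK] with x hKx
        rw [← ENNReal.ofReal_mul (by positivity)]
        refine ENNReal.ofReal_le_ofReal ?_
        calc _ ≤ _ := mul_le_mul_of_nonneg_left
              (lapReg_le_of_one_le hq1 (hε n) (hε1 n) (polarPt x.1 x.2)) hKx
          _ = _ := by ring
      · rw [lintegral_const_mul' _ _ ENNReal.ofReal_ne_top]
        refine ENNReal.mul_ne_top ENNReal.ofReal_ne_top (ne_top_of_le_ne_top hfin ?_)
        rw [lintegral_circle_reg hf hq one_pos hs0 hs1]
        exact le_self_add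
  refine tendsto_nhds_unique hA ?_
  simp_rw [hν, hEq]
  exact hB.add hC

end

/-- The Hardy–Stein identity on the circle of radius `s`. -/
theorem lintegral_circle_norm_rpow {f : ℂ → ℂ} {p : ℝ} (hf : DifferentiableOn ℂ f unitDisc)
    (hp : 0 < p) {s : ℝ} (hs0 : 0 < s) (hs1 : s < 1) :
    ∫⁻ θ in Ioo (-Real.pi) Real.pi, ENNReal.ofReal (‖f (polarPt s θ)‖ ^ p) =
      ENNReal.ofReal (p ^ 2) * (∫⁻ t in Ioo 0 s, ENNReal.ofReal (t * (Real.log s - Real.log t)) *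
        ∫⁻ θ in Ioo (-Real.pi) Real.pi,
          ENNReal.ofReal (‖f (polarPt t θ)‖ ^ (p - 2) * ‖deriv f (polarPt t θ)‖ ^ 2)) +
      ENNReal.ofReal (2 * Real.pi) * ENNReal.ofReal (‖f 0‖ ^ p) := by
  have hpow : ∀ (w : ℂ) (r : ℝ), Complex.normSq w ^ (r / 2) = ‖w‖ ^ r := fun w r => by
    rw [Complex.normSq_eq_norm_sq, ← Real.rpow_natCast, ← Real.rpow_mul (norm_nonneg _)]
    congr 1
    push_cast
    ring
  have h := lintegral_circle_rpow_normSq hf (half_pos hp) hs0 hs1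
  have hp2 : p / 2 - 1 = (p - 2) / 2 := by ring
  simp_rw [hp2, hpow, Complex.normSq_eq_norm_sq] at h
  rw [h, lintegral_prod]
  · congr 1
    rw [← lintegral_const_mul' _ _ ENNReal.ofReal_ne_top]
    refine setLIntegral_congr_fun measurableSet_Ioo fun t ht => ?_
    simp only
    rw [← lintegral_const_mul' _ _ ENNReal.ofReal_ne_top,
      ← lintegral_const_mul' _ _ ENNReal.ofReal_ne_top]
    refine lintegral_congr fun θ => ?_
    have hl := Real.log_le_log ht.1 ht.2.le
    rw [← ENNReal.ofReal_mul (mul_nonneg ht.1.le (by linarith)),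
      ← ENNReal.ofReal_mul (by positivity)]
    congr 1
    ring
  · rw [Measure.prod_restrict]
    have hsub : Ioo 0 s ×ˢ Ioo (-Real.pi) Real.pi ⊆ {x : ℝ × ℝ | |x.1| < 1} := by
      intro x hx
      show |x.1| < 1
      rw [abs_of_pos hx.1.1]
      exact hx.1.2.trans hs1
    have hm : MeasurableSet (Ioo 0 s ×ˢ Ioo (-Real.pi) Real.pi) :=
      measurableSet_Ioo.prod measurableSet_Ioo
    have h0 := ((continuousOn_comp_polarPt hf.continuousOn).mono hsub).aemeasurable hm
      (μ := (volume : Measure ℝ).prod volume)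
    have h1 := ((continuousOn_comp_polarPt (hf.deriv isOpen_unitDisc).continuousOn).mono
      hsub).aemeasurable hm (μ := (volume : Measure ℝ).prod volume)
    refine AEMeasurable.ennreal_ofReal (AEMeasurable.mul ?_ (AEMeasurable.const_mul ?_ _))
    · have : Measurable fun x : ℝ × ℝ => x.1 * (Real.log s - Real.log x.1) := by fun_prop
      exact this.aemeasurable
    · exact (h0.norm.pow_const _).mul (h1.norm.pow_const _)
lemma lintegral_unitDisc_eq {h : ℂ → ENNReal} {W : ℝ → ENNReal}
    (hm : AEMeasurable (fun x : ℝ × ℝ => h (polarPt x.1 x.2))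
      ((volume.restrict (Ioo 0 1)).prod (volume.restrict (Ioo (-Real.pi) Real.pi))))
    (hW : AEMeasurable W (volume.restrict (Ioo 0 1))) (hW' : ∀ s, W s ≠ ⊤) :
    ∫⁻ z in unitDisc, h z * W ‖z‖ =
      ∫⁻ s in Ioo 0 1, ENNReal.ofReal s * W s *
        ∫⁻ θ in Ioo (-Real.pi) Real.pi, h (polarPt s θ) := by
  have hS : MeasurableSet {x : ℝ × ℝ | x.1 < 1} := measurableSet_lt measurable_fst measurable_const
  have hT : {x : ℝ × ℝ | x.1 < 1} ∩ polarCoord.target = Ioo 0 1 ×ˢ Ioo (-Real.pi) Real.pi := by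
    ext x
    simp only [polarCoord_target, mem_inter_iff, mem_ofPred_eq, mem_prod, mem_Ioi, mem_Ioo]
    tauto
  have h1 : ∫⁻ z in unitDisc, h z * W ‖z‖ = ∫⁻ x in polarCoord.target,
      {x : ℝ × ℝ | x.1 < 1}.indicator
        (fun x => ENNReal.ofReal x.1 * W x.1 * h (polarPt x.1 x.2)) x := by
    rw [← lintegral_indicator isOpen_unitDisc.measurableSet,
      ← Complex.lintegral_comp_polarCoord_symm]
    refine setLIntegral_congr_fun polarCoord.open_target.measurableSet fun x hx => ?_
    have hx1 : 0 < x.1 := by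
      rw [polarCoord_target] at hx
      exact hx.1
    have h3 : Complex.polarCoord.symm x = polarPt x.1 x.2 := by
      simp [polarPt, Complex.polarCoord_symm_apply, Complex.exp_mul_I]
    have hn : ‖polarPt x.1 x.2‖ = x.1 := by rw [norm_polarPt, abs_of_pos hx1]
    by_cases hlt : x.1 < 1
    · have hmem : polarPt x.1 x.2 ∈ unitDisc := by
        show ‖polarPt x.1 x.2‖ < 1
        rwa [hn]
      have hmem' : x ∈ {x : ℝ × ℝ | x.1 < 1} := hlt
      simp only [h3, indicator_of_mem hmem, indicator_of_mem hmem', hn, smul_eq_mul]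
      ring
    · have hmem : polarPt x.1 x.2 ∉ unitDisc := by
        show ¬ ‖polarPt x.1 x.2‖ < 1
        rwa [hn]
      have hmem' : x ∉ {x : ℝ × ℝ | x.1 < 1} := hlt
      simp only [h3, indicator_of_notMem hmem, indicator_of_notMem hmem', smul_zero]
  rw [h1, setLIntegral_indicator hS, hT, Measure.volume_eq_prod, ← Measure.prod_restrict,
    lintegral_prod]
  · refine lintegral_congr fun s => ?_
    rw [← lintegral_const_mul' _ _ (ENNReal.mul_ne_top ENNReal.ofReal_ne_top (hW' s))]
  · exact ((measurable_fst.ennreal_ofReal.aemeasurable).mul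
      (hW.comp_quasiMeasurePreserving Measure.quasiMeasurePreserving_fst)).mul hm

lemma aemeasurable_comp_polarPt {E : Type*} [TopologicalSpace E] [MeasurableSpace E] [BorelSpace E]
    [TopologicalSpace.PseudoMetrizableSpace E] {g : ℂ → E} (hg : ContinuousOn g unitDisc) :
    AEMeasurable (fun x : ℝ × ℝ => g (polarPt x.1 x.2))
      ((volume.restrict (Ioo 0 1)).prod (volume.restrict (Ioo (-Real.pi) Real.pi))) := by
  rw [Measure.prod_restrict]
  refine ((continuousOn_comp_polarPt hg).mono ?_).aemeasurable
    (measurableSet_Ioo.prod measurableSet_Ioo)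
  intro x hx
  show |x.1| < 1
  rw [abs_of_pos hx.1.1]
  exact hx.1.2

lemma setLIntegral_eq_of_subset {α : Type*} [MeasurableSpace α] {μ : Measure α} {A B : Set α}
    {F : α → ENNReal} (hA : MeasurableSet A) (hB : MeasurableSet B) (hAB : A ⊆ B)
    (h : ∀ x ∈ B, x ∉ A → F x = 0) : ∫⁻ x in A, F x ∂μ = ∫⁻ x in B, F x ∂μ := by
  rw [← inter_eq_left.mpr hAB, ← setLIntegral_indicator hA]
  refine setLIntegral_congr_fun hB fun x hx => ?_
  by_cases hxA : x ∈ A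
  · simp [hxA]
  · simp [hxA, h x hx hxA]

lemma ofReal_wStar {ω : ℝ → ℝ} (hω : IsRadialWeight ω) {t : ℝ} (ht : t ∈ Ioo (0:ℝ) 1) :
    ENNReal.ofReal (∫ s in t..1, ω s * Real.log (s / t) * s) =
      ∫⁻ s in Ioo 0 1, ENNReal.ofReal (ω s) *
        (ENNReal.ofReal (Real.log s - Real.log t) * ENNReal.ofReal s) := by
  have hlog : ∀ s ∈ Ioo t 1, Real.log (s / t) = Real.log s - Real.log t := fun s hs =>
    Real.log_div (ht.1.trans hs.1).ne' ht.1.ne'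
  have hnn : ∀ s ∈ Ioo t 1, 0 ≤ Real.log s - Real.log t := fun s hs =>
    sub_nonneg.mpr (Real.log_le_log ht.1 hs.1.le)
  rw [intervalIntegral.integral_of_le ht.2.le, integral_Ioc_eq_integral_Ioo,
    ofReal_integral_eq_lintegral_ofReal]
  · rw [← setLIntegral_eq_of_subset (A := Ioo t 1) measurableSet_Ioo measurableSet_Ioo
      (Ioo_subset_Ioo_left ht.1.le)]
    · refine setLIntegral_congr_fun measurableSet_Ioo fun s hs => ?_
      have h0 := (hω.1 s ⟨(ht.1.trans hs.1).le, hs.2⟩).le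
      rw [hlog s hs, ENNReal.ofReal_mul (mul_nonneg h0 (hnn s hs)), ENNReal.ofReal_mul h0, mul_assoc]
    · intro s hs hst
      have hle : s ≤ t := by
        by_contra hlt
        exact hst ⟨not_le.mp hlt, hs.2⟩
      rw [ENNReal.ofReal_of_nonpos (sub_nonpos.mpr (Real.log_le_log hs.1 hle))]
      simp
  · have hω_int : IntegrableOn ω (Ioo t 1) :=
      hω.2.mono_set fun s hs => ⟨(ht.1.trans hs.1).le, hs.2⟩
    have hc : ContinuousOn (fun s => Real.log (s / t) * s) (Icc t 1) := by
      refine ContinuousOn.mul (ContinuousOn.log (by fun_prop) fun s hs => ?_) continuousOn_id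
      exact (div_pos (ht.1.trans_le hs.1) ht.1).ne'
    obtain ⟨C, hC⟩ := isCompact_Icc.exists_bound_of_continuousOn hc
    have := Integrable.mul_bdd (c := C) hω_int
      ((hc.mono Ioo_subset_Icc_self).aestronglyMeasurable measurableSet_Ioo)
      (by
        filter_upwards [ae_restrict_mem measurableSet_Ioo] with s hs
        exact hC s (Ioo_subset_Icc_self hs))
    refine this.congr (Eventually.of_forall fun s => ?_)
    simp only
    ring
  · filter_upwards [ae_restrict_mem measurableSet_Ioo] with s hs
    have h0 := (hω.1 s ⟨(ht.1.trans hs.1).le, hs.2⟩).le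
    have h1 := hnn s hs
    have h2 : 0 ≤ s := (ht.1.trans hs.1).le
    simp only [Pi.zero_apply, hlog s hs]
    positivity

theorem stmt10 (p : ℝ) (hp : 0 < p) (ω : ℝ → ℝ) (hω : IsRadialWeight ω)
    (f : ℂ → ℂ) (hf : DifferentiableOn ℂ f unitDisc) :
    (∫⁻ z in unitDisc, ENNReal.ofReal (‖f z‖ ^ p * ω ‖z‖)) =
      ENNReal.ofReal (p ^ 2) *
          (∫⁻ z in unitDisc,
            ENNReal.ofReal (‖f z‖ ^ (p - 2) * ‖deriv f z‖ ^ 2 * wStar ω z)) +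
        (∫⁻ z in unitDisc, ENNReal.ofReal (ω ‖z‖)) * ENNReal.ofReal (‖f 0‖ ^ p) := by
  have hrect : MeasurableSet (Ioo (0:ℝ) 1) := measurableSet_Ioo
  have hωm : AEMeasurable (fun s => ENNReal.ofReal (ω s)) (volume.restrict (Ioo 0 1)) :=
    (hω.2.mono_set Ioo_subset_Ico_self).aestronglyMeasurable.aemeasurable.ennreal_ofReal
  have hfm := aemeasurable_comp_polarPt hf.continuousOn
  have hdm := aemeasurable_comp_polarPt (hf.deriv isOpen_unitDisc).continuousOn
  have hgm : AEMeasurable (fun x : ℝ × ℝ => ENNReal.ofReal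
      (‖f (polarPt x.1 x.2)‖ ^ (p - 2) * ‖deriv f (polarPt x.1 x.2)‖ ^ 2))
      ((volume.restrict (Ioo 0 1)).prod (volume.restrict (Ioo (-Real.pi) Real.pi))) :=
    ((hfm.norm.pow_const _).mul (hdm.norm.pow_const _)).ennreal_ofReal
  have hkm : Measurable fun x : ℝ × ℝ =>
      ENNReal.ofReal (Real.log x.2 - Real.log x.1) * ENNReal.ofReal x.2 := by fun_prop
  set V : ℝ → ENNReal := fun t => ENNReal.ofReal (∫ s in t..1, ω s * Real.log (s / t) * s) with hV
  set J : ℝ → ENNReal := fun t => ∫⁻ θ in Ioo (-Real.pi) Real.pi, ENNReal.ofReal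
      (‖f (polarPt t θ)‖ ^ (p - 2) * ‖deriv f (polarPt t θ)‖ ^ 2) with hJ
  have hJm : AEMeasurable J (volume.restrict (Ioo 0 1)) := hgm.lintegral_prod_right'
  have hVm : AEMeasurable V (volume.restrict (Ioo 0 1)) := by
    have h : AEMeasurable (fun x : ℝ × ℝ => ENNReal.ofReal (ω x.2) *
        (ENNReal.ofReal (Real.log x.2 - Real.log x.1) * ENNReal.ofReal x.2))
        ((volume.restrict (Ioo (0:ℝ) 1)).prod (volume.restrict (Ioo 0 1))) :=
      (hωm.comp_quasiMeasurePreserving Measure.quasiMeasurePreserving_snd).mul hkm.aemeasurable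
    refine h.lintegral_prod_right'.congr ?_
    filter_upwards [ae_restrict_mem hrect] with t ht
    exact (ofReal_wStar hω ht).symm
  have hL : (∫⁻ z in unitDisc, ENNReal.ofReal (‖f z‖ ^ p * ω ‖z‖)) =
      ∫⁻ s in Ioo 0 1, ENNReal.ofReal s * ENNReal.ofReal (ω s) *
        ∫⁻ θ in Ioo (-Real.pi) Real.pi, ENNReal.ofReal (‖f (polarPt s θ)‖ ^ p) := by
    rw [← lintegral_unitDisc_eq (h := fun z => ENNReal.ofReal (‖f z‖ ^ p))
      (hfm.norm.pow_const _).ennreal_ofReal hωm fun _ => ENNReal.ofReal_ne_top]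
    exact lintegral_congr fun z => ENNReal.ofReal_mul (by positivity)
  have hR : (∫⁻ z in unitDisc,
        ENNReal.ofReal (‖f z‖ ^ (p - 2) * ‖deriv f z‖ ^ 2 * wStar ω z)) =
      ∫⁻ t in Ioo 0 1, ENNReal.ofReal t * V t * J t := by
    rw [← lintegral_unitDisc_eq
      (h := fun z => ENNReal.ofReal (‖f z‖ ^ (p - 2) * ‖deriv f z‖ ^ 2)) hgm hVm
      fun _ => ENNReal.ofReal_ne_top]
    exact lintegral_congr fun z => ENNReal.ofReal_mul (by positivity)
  have hW : (∫⁻ z in unitDisc, ENNReal.ofReal (ω ‖z‖)) =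
      (∫⁻ s in Ioo 0 1, ENNReal.ofReal s * ENNReal.ofReal (ω s)) *
        ENNReal.ofReal (2 * Real.pi) := by
    have h := lintegral_unitDisc_eq (h := fun _ => 1) aemeasurable_const hωm
      fun _ => ENNReal.ofReal_ne_top
    simp only [one_mul, setLIntegral_one, Real.volume_Ioo] at h
    rw [h, lintegral_mul_const' _ _ ENNReal.ofReal_ne_top]
    congr 2
    ring
  have hswap : ∫⁻ t in Ioo 0 1, ENNReal.ofReal t * V t * J t =
      ∫⁻ s in Ioo 0 1, ENNReal.ofReal s * ENNReal.ofReal (ω s) *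
        ∫⁻ t in Ioo 0 1, ENNReal.ofReal (Real.log s - Real.log t) * (ENNReal.ofReal t * J t) := by
    have h1 : ∀ s, ENNReal.ofReal s * ENNReal.ofReal (ω s) *
        ∫⁻ t in Ioo 0 1, ENNReal.ofReal (Real.log s - Real.log t) * (ENNReal.ofReal t * J t) =
        ∫⁻ t in Ioo 0 1, ENNReal.ofReal (ω s) *
          (ENNReal.ofReal (Real.log s - Real.log t) * ENNReal.ofReal s) *
            (ENNReal.ofReal t * J t) := fun s => by
      rw [← lintegral_const_mul' _ _
        (ENNReal.mul_ne_top ENNReal.ofReal_ne_top ENNReal.ofReal_ne_top)]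
      refine lintegral_congr fun t => ?_
      ring
    simp_rw [h1]
    rw [← lintegral_lintegral_swap (f := fun t s => ENNReal.ofReal (ω s) *
          (ENNReal.ofReal (Real.log s - Real.log t) * ENNReal.ofReal s) *
            (ENNReal.ofReal t * J t))]
    · refine setLIntegral_congr_fun hrect fun t ht => ?_
      have hk : Measurable fun s : ℝ =>
        ENNReal.ofReal (Real.log s - Real.log t) * ENNReal.ofReal s := by fun_prop
      have hk2 : AEMeasurable (fun s => ENNReal.ofReal (ω s) *
          (ENNReal.ofReal (Real.log s - Real.log t) * ENNReal.ofReal s))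
          (volume.restrict (Ioo 0 1)) := hωm.mul hk.aemeasurable
      simp only [hV]
      rw [lintegral_mul_const'' _ hk2, ofReal_wStar hω ht]
      ring
    · exact ((hωm.comp_quasiMeasurePreserving Measure.quasiMeasurePreserving_snd).mul
        hkm.aemeasurable).mul (measurable_fst.ennreal_ofReal.aemeasurable.mul
        (hJm.comp_quasiMeasurePreserving Measure.quasiMeasurePreserving_fst))
  have hcircle : ∀ s ∈ Ioo (0:ℝ) 1, ENNReal.ofReal s * ENNReal.ofReal (ω s) *
      ∫⁻ θ in Ioo (-Real.pi) Real.pi, ENNReal.ofReal (‖f (polarPt s θ)‖ ^ p) =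
      ENNReal.ofReal (p ^ 2) * (ENNReal.ofReal s * ENNReal.ofReal (ω s) *
        ∫⁻ t in Ioo 0 1, ENNReal.ofReal (Real.log s - Real.log t) * (ENNReal.ofReal t * J t)) +
      ENNReal.ofReal s * ENNReal.ofReal (ω s) *
        (ENNReal.ofReal (2 * Real.pi) * ENNReal.ofReal (‖f 0‖ ^ p)) := by
    intro s hs
    have h1 : ∫⁻ t in Ioo 0 1,
        ENNReal.ofReal (Real.log s - Real.log t) * (ENNReal.ofReal t * J t) =
        ∫⁻ t in Ioo 0 s, ENNReal.ofReal (t * (Real.log s - Real.log t)) * J t := by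
      rw [← setLIntegral_eq_of_subset (A := Ioo 0 s) measurableSet_Ioo measurableSet_Ioo
        (Ioo_subset_Ioo_right hs.2.le)]
      · refine setLIntegral_congr_fun measurableSet_Ioo fun t ht => ?_
        rw [ENNReal.ofReal_mul ht.1.le]
        ring
      · intro t ht hts
        have hle : s ≤ t := by
          by_contra hlt
          exact hts ⟨ht.1, not_le.mp hlt⟩
        rw [ENNReal.ofReal_of_nonpos (sub_nonpos.mpr (Real.log_le_log hs.1 hle)), zero_mul]
    rw [h1, lintegral_circle_norm_rpow hf hp hs.1 hs.2]
    ring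
  rw [hL, hR, hW, hswap, setLIntegral_congr_fun hrect hcircle, lintegral_add_right',
    lintegral_const_mul' _ _ ENNReal.ofReal_ne_top, lintegral_mul_const', mul_assoc]
  · exact ENNReal.mul_ne_top ENNReal.ofReal_ne_top ENNReal.ofReal_ne_top
  · exact (measurable_id.ennreal_ofReal.aemeasurable.mul hωm).mul_const _
end
end
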